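/- arXiv:2603.20550 — 12 statements merged into one kernel-verified Lean document; each statement's English description precedes it below -/
import Mathlib

section
/- For every positive integer n and all positive integers w₁, …, wₙ, the series defining the symmetrized Mordell–Tornheim zeta function ζ̄_n(w₁,…,wₙ) converges; that is, the family (a₁,…,aₙ) ↦ 1/|a₁^{w₁} ⋯ aₙ^{wₙ}|, indexed by n-tuples of nonzero integers with a₁ + … + aₙ = 0, is summable. -/
/-- The index set of the symmetrized Mordell–Tornheim zeta function:
`n`-tuples of nonzero integers summing to zero. -/
def MTIndex (n : ℕ) : Type :=
  {a : Fin n → ℤ // (∀ i, a i ≠ 0) ∧ ∑ i, a i = 0}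


theorem summable_prod_fin_aux (g : ℤ → ℝ) (hg : Summable g) (h0 : ∀ x, 0 ≤ g x) (m : ℕ) :
    Summable (fun b : Fin m → ℤ => ∏ j, g (b j)) := by
  induction m with
  | zero => exact (hasSum_fintype _).summable
  | succ m ih =>
    rw [← (Fin.consEquiv (fun _ : Fin (m+1) => ℤ)).summable_iff]
    have := Summable.mul_of_nonneg hg ih h0 (fun b => Finset.prod_nonneg fun j _ => h0 _)
    refine this.congr fun p => ?_
    simp [Fin.prod_univ_succ, Fin.consEquiv]

theorem prod_bound_aux (m : ℕ) (A : ℝ) (hA : 1 ≤ A) (b : Fin m → ℝ) (hb : ∀ j, 1 ≤ b j)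
    (hbA : ∀ j, b j ≤ A) :
    A⁻¹ * ∏ j, (b j)⁻¹ ≤ ∏ j, (b j) ^ (-(1 + 1 / ((m : ℝ) + 1))) := by
  have hm : (0:ℝ) < (m:ℝ) + 1 := by positivity
  have hA0 : 0 < A := by linarith
  set c : ℝ := A ^ (-(1 / ((m : ℝ) + 1))) with hc
  have hc0 : 0 ≤ c := by positivity
  have hc1 : c ≤ 1 := Real.rpow_le_one_of_one_le_of_nonpos hA (by
    have : 0 < 1 / ((m:ℝ)+1) := by positivity
    linarith)
  have hcm : c ^ (m+1) = A⁻¹ := by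
    rw [hc, ← Real.rpow_natCast, ← Real.rpow_mul hA0.le, ← Real.rpow_neg_one]
    congr 1
    push_cast
    field_simp
  have h1 : A⁻¹ ≤ c ^ m := by
    rw [← hcm]; exact pow_le_pow_of_le_one hc0 hc1 (Nat.le_succ m)
  calc A⁻¹ * ∏ j, (b j)⁻¹ ≤ c ^ m * ∏ j, (b j)⁻¹ := by
        refine mul_le_mul_of_nonneg_right h1 (Finset.prod_nonneg fun j _ => ?_)
        have := hb j
        positivity
    _ = ∏ j, (c * (b j)⁻¹) := by simp [Finset.prod_mul_distrib]
    _ ≤ _ := by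
        refine Finset.prod_le_prod (fun j _ => ?_) (fun j _ => ?_)
        · have := hb j
          positivity
        · have hj : 0 < b j := by linarith [hb j]
          rw [neg_add, Real.rpow_add hj, Real.rpow_neg_one, mul_comm]
          refine mul_le_mul_of_nonneg_left ?_ (by positivity)
          refine Real.rpow_le_rpow_of_nonpos hj (hbA j) ?_
          have : 0 < 1 / ((m:ℝ)+1) := by positivity
          linarith

/-- For every positive integer `n` and positive integer weights `w i`, the family
`(a₁,…,aₙ) ↦ 1/|a₁^{w 1} ⋯ aₙ^{w n}|`, indexed by `n`-tuples of nonzero integers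
with zero sum, is summable. -/
theorem symMT_summable (n : ℕ) (hn : 0 < n) (w : Fin n → ℕ) (hw : ∀ i, 0 < w i) :
    Summable (fun a : MTIndex n => 1 / |∏ i, ((a.1 i : ℝ)) ^ w i|) := by
  obtain ⟨m, rfl⟩ : ∃ m, n = m + 1 := ⟨n - 1, by omega⟩
  set s : ℝ := 1 + 1 / ((m : ℝ) + 1) with hs
  have hs1 : 1 < s := by
    have : 0 < 1 / ((m:ℝ)+1) := by positivity
    linarith
  have hg0 : ∀ x : ℤ, 0 ≤ |(x : ℝ)| ^ (-s) := fun x => by positivity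
  have hG := summable_prod_fin_aux (fun x : ℤ => |(x : ℝ)| ^ (-s))
    (Real.summable_abs_int_rpow hs1) hg0 m
  have hK : ∀ k : Fin (m+1), Summable (fun a : MTIndex (m+1) =>
      ∏ j, |((a.1 (k.succAbove j) : ℤ) : ℝ)| ^ (-s)) := by
    intro k
    refine hG.comp_injective (i := fun a : MTIndex (m+1) => fun j => a.1 (k.succAbove j)) ?_
    intro a a' h
    have h' : ∀ j, a.1 (k.succAbove j) = a'.1 (k.succAbove j) := fun j => congrFun h j
    have e1 := a.2.2
    have e2 := a'.2.2
    rw [Fin.sum_univ_succAbove _ k] at e1 e2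
    have e3 : ∑ j, a.1 (k.succAbove j) = ∑ j, a'.1 (k.succAbove j) :=
      Finset.sum_congr rfl fun j _ => h' j
    apply Subtype.ext
    funext i
    rcases Fin.eq_self_or_eq_succAbove k i with rfl | ⟨j, rfl⟩
    · omega
    · exact h' j
  have hS := summable_sum (s := Finset.univ) (fun k _ => hK k)
  refine Summable.of_nonneg_of_le (fun a => by positivity) (fun a => ?_) hS
  have h1 : ∀ i, (1 : ℝ) ≤ |(a.1 i : ℝ)| := fun i => by
    have := Int.one_le_abs (a.2.1 i)
    exact_mod_cast this
  obtain ⟨k, hk⟩ := Finite.exists_max (fun i => |(a.1 i : ℝ)|)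
  have hb := prod_bound_aux m |(a.1 k : ℝ)| (h1 k) (fun j => |(a.1 (k.succAbove j) : ℝ)|)
    (fun j => h1 _) (fun j => hk _)
  calc 1 / |∏ i, ((a.1 i : ℝ)) ^ w i| = ∏ i, (|(a.1 i : ℝ)| ^ w i)⁻¹ := by
        rw [Finset.abs_prod, one_div, ← Finset.prod_inv_distrib]
        simp only [abs_pow]
    _ ≤ ∏ i, |(a.1 i : ℝ)|⁻¹ := by
        refine Finset.prod_le_prod (fun i _ => by positivity) (fun i _ => ?_)
        have hi := h1 i
        exact inv_anti₀ (by linarith) (le_self_pow₀ hi (hw i).ne')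
    _ ≤ ∏ j, |((a.1 (k.succAbove j) : ℤ) : ℝ)| ^ (-s) := by
        rw [Fin.prod_univ_succAbove _ k]
        exact hb
    _ ≤ _ := Finset.single_le_sum
        (f := fun k : Fin (m+1) => ∏ j, |((a.1 (k.succAbove j) : ℤ) : ℝ)| ^ (-s))
        (fun k _ => Finset.prod_nonneg fun j _ => hg0 _) (Finset.mem_univ k)
end

section
/- For every integer n ≥ 2 and all positive integers w₁, …, wₙ, the symmetrized Mordell–Tornheim zeta function satisfies the bound ζ̄_n(w₁,…,wₙ) ≤ n! · 2^{2n−3} · ζ(2), where ζ is the Riemann zeta function. -/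
open scoped Nat

/-- The symmetrized Mordell–Tornheim zeta function `ζ̄_n(w₁,…,wₙ)`:
the sum of `1/|a₁^{w₁} ⋯ aₙ^{wₙ}|` over all `n`-tuples of nonzero integers
with `a₁ + … + aₙ = 0`. -/
noncomputable def symMT (n : ℕ) (w : Fin n → ℕ) : ℝ :=
  ∑' a : {a : Fin n → ℤ // (∀ i, a i ≠ 0) ∧ ∑ i, a i = 0},
    1 / |∏ i, ((a.1 i : ℝ)) ^ w i|

/-- Reciprocal with values in `ENNReal`, zero at zero. -/
noncomputable def symMT_u (n : ℕ) : ENNReal := ENNReal.ofReal ((n : ℝ)⁻¹)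

lemma symMT_u_zero : symMT_u 0 = 0 := by simp [symMT_u]

lemma symMT_u_anti {a b : ℕ} (ha : 0 < a) (h : a ≤ b) : symMT_u b ≤ symMT_u a := by
  unfold symMT_u
  apply ENNReal.ofReal_le_ofReal
  gcongr

lemma symMT_int_sum (f : ℕ → ENNReal) : ∑' x : ℤ, f x.natAbs ≤ 2 * ∑' n, f n := by
  have h1 : HasSum (fun n : ℕ => f ((n : ℤ)).natAbs) (∑' n, f n) := by
    simpa using (ENNReal.summable (f := f)).hasSum
  have h2 : HasSum (fun n : ℕ => f (-((n : ℤ) + 1)).natAbs) (∑' n, f (n + 1)) := by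
    have : (fun n : ℕ => f (-((n : ℤ) + 1)).natAbs) = fun n => f (n + 1) := by
      funext n
      congr 1
    rw [this]
    exact ENNReal.summable.hasSum
  have h3 := HasSum.of_nat_of_neg_add_one (f := fun x : ℤ => f x.natAbs) h1 h2
  rw [h3.tsum_eq, two_mul]
  refine add_le_add le_rfl ?_
  exact ENNReal.tsum_comp_le_tsum_of_injective (add_left_injective 1) f

lemma symMT_tail (c : ℕ) (hc : 0 < c) :
    ∑' n : ℕ, (if c ≤ n then symMT_u n * symMT_u n else 0) ≤ 2 * symMT_u c := by
  apply ENNReal.tsum_le_of_sum_range_le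
  intro N
  have h := sum_Ioo_inv_sq_le (α := ℝ) (c - 1) N
  have e : ∑ n ∈ Finset.range N, (if c ≤ n then symMT_u n * symMT_u n else 0)
      = ENNReal.ofReal (∑ i ∈ Finset.Ioo (c - 1) N, ((i : ℝ) ^ 2)⁻¹) := by
    rw [ENNReal.ofReal_sum_of_nonneg (fun i _ => by positivity), ← Finset.sum_filter]
    apply Finset.sum_congr
    · ext i
      simp only [Finset.mem_filter, Finset.mem_range, Finset.mem_Ioo]
      omega
    · intro i _
      rw [symMT_u, ← ENNReal.ofReal_mul (by positivity)]
      congr 1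
      rw [sq, mul_inv]
  rw [e]
  have e2 : 2 * symMT_u c = ENNReal.ofReal (2 / (((c - 1 : ℕ) : ℝ) + 1)) := by
    rw [symMT_u, div_eq_mul_inv, ENNReal.ofReal_mul (by norm_num)]
    congr 1
    · simp
    · congr 2
      have : ((c - 1 + 1 : ℕ) : ℝ) = c := by congr 1; omega
      rw [← this]; push_cast; rfl
  rw [e2]
  exact ENNReal.ofReal_le_ofReal h

lemma symMT_zeta : ∑' n : ℕ, symMT_u n * symMT_u n = ENNReal.ofReal (riemannZeta 2).re := by
  have h := hasSum_zeta_two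
  have e : (riemannZeta 2).re = Real.pi ^ 2 / 6 := by
    rw [riemannZeta_two]
    norm_cast
  rw [e, ← h.tsum_eq, ENNReal.ofReal_tsum_of_nonneg (fun n => by positivity) h.summable]
  congr 1
  funext n
  rw [symMT_u, ← ENNReal.ofReal_mul (by positivity)]
  congr 1
  rw [one_div, sq, mul_inv]

open Classical in
/-- Summand of the auxiliary sum over tuples ordered by decreasing absolute value. -/
noncomputable def symMT_g (k : ℕ) (a : Fin (k + 1) → ℤ) : ENNReal :=
  if Antitone (fun i => (a i).natAbs) then
    (∏ i, symMT_u (a i).natAbs) * symMT_u (a 0).natAbs else 0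

lemma symMT_anti_tail {k : ℕ} {x : ℤ} {a : Fin (k + 1) → ℤ}
    (h : Antitone (fun i => ((Fin.cons x a : Fin (k + 2) → ℤ) i).natAbs)) :
    Antitone (fun i => (a i).natAbs) ∧ (a 0).natAbs ≤ x.natAbs := by
  constructor
  · intro i j hij
    have := h (Fin.succ_le_succ_iff.mpr hij)
    simpa using this
  · have := h (Fin.zero_le (Fin.succ (0 : Fin (k + 1))))
    simpa using this

lemma symMT_tsum_cons (k : ℕ) (f : (Fin (k + 1) → ℤ) → ENNReal) :
    ∑' a, f a = ∑' a : Fin k → ℤ, ∑' x : ℤ, f (Fin.cons x a) := by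
  rw [← (Fin.consEquiv (fun _ : Fin (k + 1) => ℤ)).tsum_eq f, ENNReal.tsum_prod', ENNReal.tsum_comm]
  rfl

lemma symMT_g_sum (k : ℕ) :
    ∑' a, symMT_g k a ≤ 4 ^ k * (2 * ENNReal.ofReal (riemannZeta 2).re) := by
  induction k with
  | zero =>
    rw [← (Equiv.funUnique (Fin 1) ℤ).symm.tsum_eq, pow_zero, one_mul, ← symMT_zeta]
    refine le_trans (ENNReal.tsum_le_tsum fun x => ?_)
      (symMT_int_sum (fun n => symMT_u n * symMT_u n))
    unfold symMT_g
    split_ifs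
    · simp
    · simp
  | succ k ih =>
    rw [symMT_tsum_cons, pow_succ', mul_assoc]
    refine le_trans ?_ (mul_le_mul_right ih 4)
    rw [← ENNReal.tsum_mul_left]
    refine ENNReal.tsum_le_tsum fun a => ?_
    by_cases ha : Antitone (fun i => (a i).natAbs)
    · by_cases h0 : (a 0).natAbs = 0
      · have : ∀ x : ℤ, symMT_g (k + 1) (Fin.cons x a) = 0 := by
          intro x
          unfold symMT_g
          split_ifs
          · rw [Fin.prod_univ_succ]
            simp only [Fin.cons_succ]
            rw [Finset.prod_eq_zero (Finset.mem_univ (0 : Fin (k + 1)))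
              (by rw [h0, symMT_u_zero])]
            simp
          · rfl
        simp [this]
      · have h1 : ∀ x : ℤ, symMT_g (k + 1) (Fin.cons x a) ≤ (∏ i, symMT_u (a i).natAbs) *
            (fun n => if (a 0).natAbs ≤ n then symMT_u n * symMT_u n else 0) x.natAbs := by
          intro x
          unfold symMT_g
          split_ifs with h
          · rw [Fin.prod_univ_succ]
            simp only [Fin.cons_succ, Fin.cons_zero]
            rw [if_pos (symMT_anti_tail h).2]
            apply le_of_eq
            ring
          · exact zero_le
        refine le_trans (ENNReal.tsum_le_tsum h1) ?_
        rw [ENNReal.tsum_mul_left]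
        have h2 := le_trans (symMT_int_sum _)
          (mul_le_mul_right (symMT_tail _ (Nat.pos_of_ne_zero h0)) 2)
        refine le_trans (mul_le_mul_right h2 _) ?_
        rw [symMT_g, if_pos ha]
        apply le_of_eq
        ring
    · have : ∀ x : ℤ, symMT_g (k + 1) (Fin.cons x a) = 0 := by
        intro x
        rw [symMT_g, if_neg]
        exact fun h => ha (symMT_anti_tail h).1
      simp [this]

open Classical in
/-- Summand for zero-sum tuples ordered by decreasing absolute value. -/
noncomputable def symMT_h (n : ℕ) (a : Fin n → ℤ) : ENNReal :=
  if Antitone (fun i => (a i).natAbs) ∧ ∑ i, a i = 0 then ∏ i, symMT_u (a i).natAbs else 0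

lemma symMT_h_sum (m : ℕ) : ∑' a, symMT_h (m + 2) a ≤ ∑' a, symMT_g m a := by
  rw [symMT_tsum_cons]
  refine ENNReal.tsum_le_tsum fun a => ?_
  rw [tsum_eq_single (-∑ i, a i)]
  · unfold symMT_h
    split_ifs with h
    · obtain ⟨h1, h2⟩ := symMT_anti_tail h.1
      rw [symMT_g, if_pos h1, Fin.prod_univ_succ]
      simp only [Fin.cons_succ, Fin.cons_zero]
      by_cases h0 : (a 0).natAbs = 0
      · rw [Finset.prod_eq_zero (Finset.mem_univ (0 : Fin (m + 1)))
              (by rw [h0, symMT_u_zero])]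
        simp
      · rw [mul_comm]
        gcongr
        exact symMT_u_anti (Nat.pos_of_ne_zero h0) h2
    · exact zero_le
  · intro x hx
    rw [symMT_h, if_neg]
    rintro ⟨-, h⟩
    rw [Fin.sum_univ_succ] at h
    simp only [Fin.cons_succ, Fin.cons_zero] at h
    exact hx (by omega)

lemma symMT_term (n : ℕ) (w : Fin n → ℕ) (hw : ∀ i, 0 < w i) (a : Fin n → ℤ)
    (ha : ∀ i, a i ≠ 0) (hs : ∑ i, a i = 0) :
    ENNReal.ofReal (1 / |∏ i, ((a i : ℝ)) ^ w i|) ≤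
      ∑ σ : Equiv.Perm (Fin n), symMT_h n (fun i => a (σ i)) := by
  let f : Fin n → ℕᵒᵈ := fun i => OrderDual.toDual (a i).natAbs
  have hmono : Monotone (f ∘ Tuple.sort f) := Tuple.monotone_sort f
  have hanti : Antitone (fun i => (a (Tuple.sort f i)).natAbs) := fun i j hij => hmono hij
  refine le_trans ?_ (Finset.single_le_sum
    (f := fun σ : Equiv.Perm (Fin n) => symMT_h n (fun i => a (σ i)))
    (fun _ _ => zero_le) (Finset.mem_univ (Tuple.sort f)))
  rw [symMT_h, if_pos ⟨hanti, by rw [Equiv.sum_comp (Tuple.sort f) a]; exact hs⟩,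
    Equiv.prod_comp (Tuple.sort f) (fun i => symMT_u (a i).natAbs)]
  unfold symMT_u
  rw [← ENNReal.ofReal_prod_of_nonneg (fun i _ => by positivity)]
  apply ENNReal.ofReal_le_ofReal
  rw [Finset.abs_prod, one_div, ← Finset.prod_inv_distrib]
  apply Finset.prod_le_prod
  · intro i _; positivity
  · intro i _
    have h1 : (1 : ℝ) ≤ ((a i).natAbs : ℝ) := by
      exact_mod_cast Nat.one_le_iff_ne_zero.mpr (Int.natAbs_ne_zero.mpr (ha i))
    have h2 : |(a i : ℝ)| = ((a i).natAbs : ℝ) := by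
      rw [Nat.cast_natAbs]; push_cast; rfl
    rw [abs_pow, h2]
    apply inv_anti₀ (by linarith)
    exact le_self_pow₀ h1 (Nat.pos_iff_ne_zero.mp (hw i))

/-- For `n ≥ 2` and positive integer weights, the symmetrized Mordell–Tornheim
zeta function is bounded by `n! · 2^(2n-3) · ζ(2)`. -/
theorem symMT_le (n : ℕ) (hn : 2 ≤ n) (w : Fin n → ℕ) (hw : ∀ i, 0 < w i) :
    symMT n w ≤ (n ! : ℝ) * 2 ^ (2 * n - 3) * (riemannZeta 2).re := by
  obtain ⟨m, rfl⟩ : ∃ m, n = m + 2 := ⟨n - 2, by omega⟩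
  have hz : 0 ≤ (riemannZeta 2).re := by
    have e : (riemannZeta 2).re = Real.pi ^ 2 / 6 := by
      rw [riemannZeta_two]
      norm_cast
    rw [e]; positivity
  have key : ∑' a : {a : Fin (m + 2) → ℤ // (∀ i, a i ≠ 0) ∧ ∑ i, a i = 0},
      ENNReal.ofReal (1 / |∏ i, ((a.1 i : ℝ)) ^ w i|) ≤
      ENNReal.ofReal (((m + 2) ! : ℝ) * 2 ^ (2 * (m + 2) - 3) * (riemannZeta 2).re) := by
    calc _ ≤ ∑' a : {a : Fin (m + 2) → ℤ // (∀ i, a i ≠ 0) ∧ ∑ i, a i = 0},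
          (fun a : Fin (m + 2) → ℤ =>
            ∑ σ : Equiv.Perm (Fin (m + 2)), symMT_h (m + 2) (fun i => a (σ i))) a.1 :=
          ENNReal.tsum_le_tsum fun a => symMT_term _ w hw a.1 a.2.1 a.2.2
      _ ≤ ∑' a : Fin (m + 2) → ℤ,
            ∑ σ : Equiv.Perm (Fin (m + 2)), symMT_h (m + 2) (fun i => a (σ i)) :=
          ENNReal.tsum_comp_le_tsum_of_injective Subtype.val_injective _
      _ = ∑ σ : Equiv.Perm (Fin (m + 2)), ∑' a : Fin (m + 2) → ℤ,
            symMT_h (m + 2) (fun i => a (σ i)) :=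
          Summable.tsum_finsetSum fun _ _ => ENNReal.summable
      _ = ∑ σ : Equiv.Perm (Fin (m + 2)), ∑' a : Fin (m + 2) → ℤ, symMT_h (m + 2) a := by
          refine Finset.sum_congr rfl fun σ _ => ?_
          exact (Equiv.arrowCongr σ.symm (Equiv.refl ℤ)).tsum_eq (symMT_h (m + 2))
      _ = ((m + 2) ! : ENNReal) * ∑' a : Fin (m + 2) → ℤ, symMT_h (m + 2) a := by
          rw [Finset.sum_const, nsmul_eq_mul, Finset.card_univ, Fintype.card_perm,
            Fintype.card_fin]
      _ ≤ ((m + 2) ! : ENNReal) * (4 ^ m * (2 * ENNReal.ofReal (riemannZeta 2).re)) := by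
          gcongr
          exact (symMT_h_sum m).trans (symMT_g_sum m)
      _ = _ := by
          rw [ENNReal.ofReal_mul (by positivity), ENNReal.ofReal_mul (by positivity),
            ENNReal.ofReal_natCast, ENNReal.ofReal_pow (by norm_num)]
          have : 2 * (m + 2) - 3 = 2 * m + 1 := by omega
          rw [this, pow_succ, pow_mul, ENNReal.ofReal_ofNat]
          norm_num
          ring
  have e : symMT (m + 2) w = (∑' a : {a : Fin (m + 2) → ℤ // (∀ i, a i ≠ 0) ∧ ∑ i, a i = 0},
      ENNReal.ofReal (1 / |∏ i, ((a.1 i : ℝ)) ^ w i|)).toReal := by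
    rw [ENNReal.tsum_toReal_eq (fun _ => ENNReal.ofReal_ne_top), symMT]
    congr 1
    funext a
    rw [ENNReal.toReal_ofReal (by positivity)]
  rw [e]
  exact ENNReal.toReal_le_of_le_ofReal (by positivity) key
end

section
/- For every positive integer p, the sum over all p-tuples (l₁,…,l_p) of positive integers of 1/(l₁ l₂ ⋯ l_p · (l₁ + … + l_p)) equals Γ(p+1) · ζ(p+1) = p! · ζ(p+1), where ζ is the Riemann zeta function. -/
open scoped Nat

open MeasureTheory Set in
/-- Laplace-type integral, in `ℝ≥0∞`. -/
lemma aux_lint (p : ℕ) (r : ℝ) (hr : 0 < r) :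
    ∫⁻ t in Ioi (0:ℝ), ENNReal.ofReal (t ^ p * Real.exp (-(r * t)))
      = ENNReal.ofReal ((p ! : ℝ) / r ^ (p + 1)) := by
  have h := Real.integral_rpow_mul_exp_neg_mul_Ioi (a := (p:ℝ) + 1) (by positivity) hr
  have e : ((p:ℝ) + 1 - 1) = p := by ring
  simp only [e, Real.rpow_natCast] at h
  rw [Real.Gamma_nat_eq_factorial] at h
  have h2 : ((1 / r) ^ ((p:ℝ) + 1) : ℝ) * (p ! : ℝ) = (p ! : ℝ) / r ^ (p + 1) := by
    have : ((p:ℝ) + 1) = ((p + 1 : ℕ) : ℝ) := by push_cast; ring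
    rw [this, Real.rpow_natCast, div_pow, one_pow]
    ring
  rw [h2] at h
  rw [← h, ofReal_integral_eq_lintegral_ofReal]
  · by_contra hc
    rw [integral_undef hc] at h
    have : 0 < (p ! : ℝ) / r ^ (p + 1) := by positivity
    linarith
  · filter_upwards [ae_restrict_mem measurableSet_Ioi] with t ht
    have : (0:ℝ) < t := ht
    positivity

/-- Power of a series of nonnegative terms. -/
lemma aux_pow (f : ℕ+ → ENNReal) (p : ℕ) :
    ∑' l : Fin p → ℕ+, ∏ i, f (l i) = (∑' n, f n) ^ p := by
  induction p with
  | zero => simp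
  | succ p ih =>
    rw [← (Fin.consEquiv (fun _ : Fin (p+1) => ℕ+)).tsum_eq, ENNReal.tsum_prod']
    simp only [Fin.consEquiv_apply, Fin.prod_univ_succ, Fin.cons_zero, Fin.cons_succ]
    simp only [ENNReal.tsum_mul_left, ENNReal.tsum_mul_right, ih]
    ring

/-- `G t = -log (1 - e^{-t})`. -/
noncomputable def auxG (t : ℝ) : ℝ := -Real.log (1 - Real.exp (-t))

lemma aux_exp_lt {t : ℝ} (ht : 0 < t) : Real.exp (-t) < 1 := by
  rw [Real.exp_lt_one_iff]; linarith

lemma auxG_pos {t : ℝ} (ht : 0 < t) : 0 < auxG t := by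
  unfold auxG
  have := aux_exp_lt ht
  have := Real.exp_pos (-t)
  have := Real.log_neg (x := 1 - Real.exp (-t)) (by linarith) (by linarith)
  linarith

lemma auxG_invol {t : ℝ} (ht : 0 < t) : auxG (auxG t) = t := by
  have := aux_exp_lt ht
  unfold auxG
  rw [neg_neg, Real.exp_log (by linarith)]
  simp

lemma auxG_deriv {t : ℝ} (ht : 0 < t) :
    HasDerivAt auxG (-(Real.exp (-t) / (1 - Real.exp (-t)))) t := by
  have := aux_exp_lt ht
  have h1 : HasDerivAt (fun t : ℝ => 1 - Real.exp (-t)) (Real.exp (-t)) t := by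
    have := ((hasDerivAt_neg t).exp).const_sub 1
    simpa using this
  exact (h1.log (by linarith)).neg

lemma auxG_series {t : ℝ} (ht : 0 < t) :
    ∑' n : ℕ+, ENNReal.ofReal (Real.exp (-((n:ℕ) * t)) / (n:ℕ)) = ENNReal.ofReal (auxG t) := by
  have h := Real.hasSum_pow_div_log_of_abs_lt_one (x := Real.exp (-t))
    (by rw [abs_of_pos (Real.exp_pos _)]; exact aux_exp_lt ht)
  have key : ∀ n : ℕ, Real.exp (-t) ^ (n+1) / ((n:ℝ)+1)
      = Real.exp (-(((n+1 : ℕ):ℝ) * t)) / ((n+1 : ℕ):ℝ) := by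
    intro n
    rw [← Real.exp_nat_mul]
    push_cast
    congr 2
    ring
  rw [tsum_pnat_eq_tsum_succ (f := fun n : ℕ => ENNReal.ofReal (Real.exp (-((n:ℝ) * t)) / (n:ℝ)))]
  unfold auxG
  rw [← h.tsum_eq, ENNReal.ofReal_tsum_of_nonneg _ h.summable]
  · simp only [key]
  · intro n; positivity

lemma aux_geom {t : ℝ} (ht : 0 < t) :
    ENNReal.ofReal (Real.exp (-t) / (1 - Real.exp (-t)))
      = ∑' n : ℕ, ENNReal.ofReal (Real.exp (-(((n:ℝ)+1) * t))) := by
  have h := (hasSum_geometric_of_lt_one (Real.exp_pos (-t)).le (aux_exp_lt ht)).mul_left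
    (Real.exp (-t))
  rw [div_eq_mul_inv, ← h.tsum_eq, ENNReal.ofReal_tsum_of_nonneg _ h.summable]
  · congr 1; ext n
    rw [← Real.exp_nat_mul, ← Real.exp_add]
    congr 2; ring
  · intro n; positivity

open MeasureTheory Set in
lemma aux_subst (p : ℕ) :
    ∫⁻ t in Ioi (0:ℝ), ENNReal.ofReal (auxG t) ^ p
      = ∫⁻ u in Ioi (0:ℝ), ENNReal.ofReal (Real.exp (-u) / (1 - Real.exp (-u)))
          * ENNReal.ofReal u ^ p := by
  have him : auxG '' Ioi (0:ℝ) = Ioi 0 := by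
    ext x
    constructor
    · rintro ⟨t, ht, rfl⟩; exact auxG_pos ht
    · intro hx; exact ⟨auxG x, auxG_pos hx, auxG_invol hx⟩
  have hinj : InjOn auxG (Ioi (0:ℝ)) := by
    intro a ha b hb hab
    rw [← auxG_invol ha, hab, auxG_invol hb]
  have := lintegral_image_eq_lintegral_abs_deriv_mul measurableSet_Ioi
    (fun x hx => (auxG_deriv hx).hasDerivWithinAt) hinj
    (fun t => ENNReal.ofReal (auxG t) ^ p)
  rw [him] at this
  rw [this]
  refine setLIntegral_congr_fun measurableSet_Ioi ?_
  intro u hu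
  have h1 := aux_exp_lt hu
  have h2 := Real.exp_pos (-u)
  simp only
  rw [auxG_invol hu, abs_neg, abs_of_pos (div_pos h2 (by linarith))]

open MeasureTheory Set in
lemma aux_main (p : ℕ) (hp : 0 < p) :
    ∑' l : Fin p → ℕ+, ENNReal.ofReal
        (1 / ((∏ i, ((l i : ℕ) : ℝ)) * ∑ i, ((l i : ℕ) : ℝ)))
      = ∑' n : ℕ, ENNReal.ofReal ((p ! : ℝ) / ((n:ℝ)+1) ^ (p+1)) := by
  have : Nonempty (Fin p) := ⟨⟨0, hp⟩⟩
  have hterm : ∀ l : Fin p → ℕ+, ENNReal.ofReal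
        (1 / ((∏ i, ((l i : ℕ) : ℝ)) * ∑ i, ((l i : ℕ) : ℝ)))
      = ∫⁻ t in Ioi (0:ℝ), ∏ i, ENNReal.ofReal (Real.exp (-((l i : ℕ) * t)) / (l i : ℕ)) := by
    intro l
    have hpos : ∀ i, (0:ℝ) < ((l i : ℕ) : ℝ) := fun i => by exact_mod_cast (l i).pos
    have hS : 0 < ∑ i, ((l i : ℕ) : ℝ) :=
      Finset.sum_pos (fun i _ => hpos i) Finset.univ_nonempty
    have hP : 0 < ∏ i, ((l i : ℕ) : ℝ) := Finset.prod_pos (fun i _ => hpos i)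
    have e : ∀ t : ℝ, ∏ i, ENNReal.ofReal (Real.exp (-((l i : ℕ) * t)) / (l i : ℕ))
        = ENNReal.ofReal (1 / ∏ i, ((l i : ℕ) : ℝ)) *
          ENNReal.ofReal (t ^ 0 * Real.exp (-((∑ i, ((l i : ℕ) : ℝ)) * t))) := by
      intro t
      rw [← ENNReal.ofReal_prod_of_nonneg (fun i _ => by positivity),
        ← ENNReal.ofReal_mul (by positivity), Finset.prod_div_distrib, ← Real.exp_sum,
        Finset.sum_neg_distrib, ← Finset.sum_mul]
      congr 1
      ring
    simp only [e]
    rw [lintegral_const_mul' _ _ ENNReal.ofReal_ne_top, aux_lint 0 _ hS,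
      ← ENNReal.ofReal_mul (by positivity)]
    congr 1
    simp
    ring
  simp only [hterm]
  rw [← lintegral_tsum (fun l => by fun_prop)]
  have h2 : ∫⁻ t in Ioi (0:ℝ), ∑' l : Fin p → ℕ+,
        ∏ i, ENNReal.ofReal (Real.exp (-((l i : ℕ) * t)) / (l i : ℕ))
      = ∫⁻ t in Ioi (0:ℝ), ENNReal.ofReal (auxG t) ^ p := by
    refine setLIntegral_congr_fun measurableSet_Ioi ?_
    intro t ht
    simp only
    rw [aux_pow (fun n => ENNReal.ofReal (Real.exp (-((n : ℕ) * t)) / (n : ℕ))), auxG_series ht]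
  rw [h2, aux_subst]
  have h3 : ∫⁻ u in Ioi (0:ℝ), ENNReal.ofReal (Real.exp (-u) / (1 - Real.exp (-u)))
          * ENNReal.ofReal u ^ p
      = ∫⁻ u in Ioi (0:ℝ), ∑' n : ℕ, ENNReal.ofReal (u ^ p * Real.exp (-(((n:ℝ)+1) * u))) := by
    refine setLIntegral_congr_fun measurableSet_Ioi ?_
    intro u hu
    have hu' : (0:ℝ) < u := hu
    simp only
    rw [aux_geom hu, mul_comm, ← ENNReal.tsum_mul_left]
    congr 1; ext n
    rw [ENNReal.ofReal_mul (by positivity), ENNReal.ofReal_pow hu'.le]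
  rw [h3, lintegral_tsum (fun l => by fun_prop)]
  congr 1; ext n
  exact aux_lint p _ (by positivity)

/-- For every positive integer `p`, the sum over all `p`-tuples of positive
integers `(l₁,…,l_p)` of `1/(l₁⋯l_p·(l₁+…+l_p))` equals
`Γ(p+1)·ζ(p+1) = p!·ζ(p+1)`. -/
theorem tsum_inv_prod_mul_sum (p : ℕ) (hp : 0 < p) :
    ((∑' l : Fin p → ℕ+, 1 / ((∏ i, ((l i : ℕ) : ℝ)) * ∑ i, ((l i : ℕ) : ℝ)) : ℝ) : ℂ)
      = (Real.Gamma ((p : ℝ) + 1) : ℂ) * riemannZeta ((p : ℂ) + 1) ∧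
    Real.Gamma ((p : ℝ) + 1) = (p ! : ℝ) := by
  refine ⟨?_, Real.Gamma_nat_eq_factorial p⟩
  have h := congrArg ENNReal.toReal (aux_main p hp)
  rw [ENNReal.tsum_toReal_eq (fun _ => ENNReal.ofReal_ne_top),
    ENNReal.tsum_toReal_eq (fun _ => ENNReal.ofReal_ne_top)] at h
  have e1 : ∀ l : Fin p → ℕ+, (ENNReal.ofReal
        (1 / ((∏ i, ((l i : ℕ) : ℝ)) * ∑ i, ((l i : ℕ) : ℝ)))).toReal
      = 1 / ((∏ i, ((l i : ℕ) : ℝ)) * ∑ i, ((l i : ℕ) : ℝ)) :=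
    fun l => ENNReal.toReal_ofReal (by positivity)
  have e2 : ∀ n : ℕ, (ENNReal.ofReal ((p ! : ℝ) / ((n:ℝ)+1) ^ (p+1))).toReal
      = (p ! : ℝ) / ((n:ℝ)+1) ^ (p+1) :=
    fun n => ENNReal.toReal_ofReal (by positivity)
  simp only [e1, e2] at h
  rw [h, Real.Gamma_nat_eq_factorial,
    zeta_eq_tsum_one_div_nat_add_one_cpow (by simpa using hp), Complex.ofReal_tsum, ← tsum_mul_left]
  congr 1; ext n
  have : ((p:ℂ) + 1) = ((p + 1 : ℕ) : ℂ) := by push_cast; ring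
  rw [this, Complex.cpow_natCast]
  push_cast
  ring
end

section
/- For every positive integer p, the improper integral ∫₀¹ (−ln(1−t))^p / t dt converges and equals Γ(p+1) · ζ(p+1) = p! · ζ(p+1), where ζ is the Riemann zeta function. -/
open scoped Nat

theorem aux_hasSum (p : ℕ) (hp : 0 < p) :
    HasSum (fun n : ℕ => Complex.Gamma ((p : ℂ) + 1) * 1 / (((n : ℝ) + 1 : ℝ) : ℂ) ^ ((p : ℂ) + 1))
      (mellin (fun x : ℝ => ((Real.exp (-x) / (1 - Real.exp (-x)) : ℝ) : ℂ)) ((p : ℂ) + 1)) := by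
  refine hasSum_mellin (a := fun _ => 1) (p := fun n : ℕ => (n : ℝ) + 1) (fun n => Or.inr (by positivity))
    (by simp; positivity) ?_ ?_
  · intro t ht
    have ht' : (0 : ℝ) < t := ht
    have h1 : Real.exp (-t) < 1 := by simpa using ht'
    have := (hasSum_geometric_of_lt_one (Real.exp_pos (-t)).le h1).mul_left (Real.exp (-t))
    rw [← div_eq_mul_inv] at this
    have h2 := Complex.hasSum_ofReal.mpr this
    refine h2.congr_fun fun n => ?_
    rw [one_mul, ← Real.exp_nat_mul, ← Real.exp_add]
    congr 2
    ring
  · have : Summable (fun n : ℕ => 1 / ((n : ℝ) ^ ((p : ℝ) + 1))) :=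
      Real.summable_one_div_nat_rpow.mpr (by simpa using hp)
    have := (summable_nat_add_iff 1).mpr this
    simpa using this

theorem aux_mellin (p : ℕ) (hp : 0 < p) :
    mellin (fun x : ℝ => ((Real.exp (-x) / (1 - Real.exp (-x)) : ℝ) : ℂ)) ((p : ℂ) + 1)
      = (Real.Gamma ((p : ℝ) + 1) : ℂ) * riemannZeta ((p : ℂ) + 1) := by
  rw [← (aux_hasSum p hp).tsum_eq, zeta_eq_tsum_one_div_nat_add_one_cpow (by simpa using hp),
    ← tsum_mul_left, ← Complex.Gamma_ofReal]
  push_cast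
  simp only [mul_div_assoc]

theorem aux_image : (fun x : ℝ => 1 - Real.exp (-x)) '' Set.Ioi 0 = Set.Ioo 0 1 := by
  ext t
  constructor
  · rintro ⟨x, hx, rfl⟩
    have hx' : (0 : ℝ) < x := hx
    have h1 : Real.exp (-x) < 1 := by simpa using hx'
    exact ⟨by simpa using hx', by simpa using Real.exp_pos (-x)⟩
  · rintro ⟨h0, h1⟩
    refine ⟨-Real.log (1 - t), ?_, ?_⟩
    · have := Real.log_neg (x := 1 - t) (by linarith) (by linarith)
      simpa using this
    · simp only [neg_neg]
      rw [Real.exp_log (by linarith)]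
      ring

theorem aux_integral (p : ℕ) (hp : 0 < p) :
    ((∫ t in Set.Ioo (0 : ℝ) 1, (-Real.log (1 - t)) ^ p / t : ℝ) : ℂ)
      = (Real.Gamma ((p : ℝ) + 1) : ℂ) * riemannZeta ((p : ℂ) + 1) := by
  rw [← aux_mellin p hp, ← aux_image,
    MeasureTheory.integral_image_eq_integral_abs_deriv_smul (f' := fun x => Real.exp (-x))
      measurableSet_Ioi, mellin, ← integral_complex_ofReal]
  · refine MeasureTheory.setIntegral_congr_fun measurableSet_Ioi fun x hx => ?_
    simp only [sub_sub_cancel, Real.log_exp, neg_neg, abs_of_pos (Real.exp_pos _), smul_eq_mul,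
      add_sub_cancel_right, Complex.cpow_natCast]
    push_cast
    ring
  · intro x hx
    have := ((hasDerivAt_neg x).exp.const_sub 1).hasDerivWithinAt (s := Set.Ioi 0)
    simpa using this
  · intro x _ y _ h
    simpa using h

/-- For every positive integer `p`, the improper integral
`∫₀¹ (−ln(1−t))^p / t dt` converges and equals `Γ(p+1)·ζ(p+1) = p!·ζ(p+1)`. -/
theorem integral_neg_log_pow_div (p : ℕ) (hp : 0 < p) :
    MeasureTheory.IntegrableOn (fun t : ℝ => (-Real.log (1 - t)) ^ p / t) (Set.Ioo 0 1) ∧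
    ((∫ t in Set.Ioo (0 : ℝ) 1, (-Real.log (1 - t)) ^ p / t : ℝ) : ℂ)
      = (Real.Gamma ((p : ℝ) + 1) : ℂ) * riemannZeta ((p : ℂ) + 1) ∧
    Real.Gamma ((p : ℝ) + 1) = (p ! : ℝ) := by
  refine ⟨?_, aux_integral p hp, Real.Gamma_nat_eq_factorial p⟩
  by_contra h
  have h1 := aux_integral p hp
  rw [MeasureTheory.integral_undef h, Complex.ofReal_zero] at h1
  have h2 : riemannZeta ((p : ℂ) + 1) ≠ 0 := riemannZeta_ne_zero_of_one_le_re (by simp)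
  have h3 : (Real.Gamma ((p : ℝ) + 1) : ℂ) ≠ 0 :=
    Complex.ofReal_ne_zero.mpr (Real.Gamma_pos_of_pos (by positivity)).ne'
  exact mul_ne_zero h3 h2 h1.symm
end

section
/- For every positive integer p, the series Σ_{s=1}^{∞} [s brack p] / (s · s!) converges and equals ζ(p+1), where [s brack p] is the unsigned Stirling number of the first kind and ζ is the Riemann zeta function. -/
open scoped Nat

/-- Normalized Stirling numbers `[s brack j] / s!`. -/
noncomputable def stW (j s : ℕ) : ℝ := ((ascPochhammer ℕ s).coeff j : ℝ) / (s ! : ℝ)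

/-- The connector `n! b! / (n+b)!`. -/
noncomputable def stC (n b : ℕ) : ℝ := ((n ! : ℝ) * (b ! : ℝ)) / ((n + b)! : ℝ)

lemma stW_nonneg (j s : ℕ) : 0 ≤ stW j s := by unfold stW; positivity
lemma stC_nonneg (j s : ℕ) : 0 ≤ stC j s := by unfold stC; positivity

lemma stW_zero_succ (s : ℕ) : stW 0 (s + 1) = 0 := by
  simp [stW, Polynomial.coeff_zero_eq_eval_zero]

lemma stW_zero_zero : stW 0 0 = 1 := by simp [stW]

lemma stW_succ_zero (j : ℕ) : stW (j + 1) 0 = 0 := by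
  simp [stW, Polynomial.coeff_one]

lemma stW_rec (j s : ℕ) :
    ((s : ℝ) + 1) * stW (j + 1) (s + 1) = s * stW (j + 1) s + stW j s := by
  have h : (ascPochhammer ℕ (s + 1)).coeff (j + 1)
      = (ascPochhammer ℕ s).coeff j + (ascPochhammer ℕ s).coeff (j + 1) * s := by
    rw [ascPochhammer_succ_right, mul_add, Polynomial.coeff_add, Polynomial.coeff_mul_X,
      Polynomial.coeff_mul_natCast]
    simp
  unfold stW
  rw [h, Nat.factorial_succ]
  push_cast
  have : (s ! : ℝ) ≠ 0 := by positivity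
  field_simp
  ring

lemma stW_sum (j s : ℕ) : (s : ℝ) * stW (j + 1) s = ∑ t ∈ Finset.range s, stW j t := by
  induction s with
  | zero => simp
  | succ s ih => rw [Finset.sum_range_succ, ← ih, ← stW_rec]; push_cast; ring

lemma stC_diff (n b : ℕ) :
    stC n b - stC n (b + 1) = n * (stC n (b + 1) / ((b : ℝ) + 1)) := by
  unfold stC
  rw [← add_assoc, Nat.factorial_succ (n + b), Nat.factorial_succ b]
  push_cast
  have h1 : ((n + b)! : ℝ) ≠ 0 := by positivity
  have h2 : (n : ℝ) + b + 1 ≠ 0 := by positivity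
  have h3 : (b : ℝ) + 1 ≠ 0 := by positivity
  field_simp
  ring

lemma stC_symm (n b : ℕ) : stC n b = stC b n := by
  unfold stC; rw [mul_comm, add_comm n b]

lemma stC_zero (n : ℕ) : stC n 0 = 1 := by
  unfold stC
  have h1 : (n ! : ℝ) ≠ 0 := by positivity
  simp [h1]

lemma stC_le (n b : ℕ) : stC (n + 1) b ≤ 1 / ((b : ℝ) + 1) := by
  induction n with
  | zero =>
    unfold stC
    rw [zero_add, add_comm 1 b, Nat.factorial_succ b]
    push_cast
    have h1 : (b ! : ℝ) ≠ 0 := by positivity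
    apply le_of_eq
    simp
    field_simp
  | succ n ih =>
    refine le_trans ?_ ih
    have := stC_diff b (n + 1)
    rw [stC_symm b, stC_symm b] at this
    have h2 : 0 ≤ (b : ℝ) * (stC (n + 1 + 1) b / (((n + 1 : ℕ) : ℝ) + 1)) := by
      have := stC_nonneg (n + 1 + 1) b
      positivity
    linarith

lemma stC_tendsto (n : ℕ) (hn : 0 < n) :
    Filter.Tendsto (fun b => stC n b) Filter.atTop (nhds 0) := by
  obtain ⟨k, rfl⟩ : ∃ k, n = k + 1 := ⟨n - 1, by omega⟩
  exact squeeze_zero (stC_nonneg _) (stC_le k) tendsto_one_div_add_atTop_nhds_zero_nat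

lemma stC_tele (n m : ℕ) (hn : 0 < n) :
    HasSum (fun i : ℕ => stC n (i + (m + 1)) / ((i + (m + 1) : ℕ) : ℝ)) (stC n m / n) := by
  have hn' : (n : ℝ) ≠ 0 := by positivity
  rw [hasSum_iff_tendsto_nat_of_nonneg
    (fun i => div_nonneg (stC_nonneg _ _) (Nat.cast_nonneg _))]
  have h : ∀ N : ℕ, ∑ i ∈ Finset.range N, stC n (i + (m + 1)) / ((i + (m + 1) : ℕ) : ℝ)
      = (stC n m - stC n (N + m)) / n := by
    intro N
    induction N with
    | zero => simp
    | succ N ih =>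
      rw [Finset.sum_range_succ, ih]
      have := stC_diff n (N + m)
      rw [show N + (m + 1) = N + m + 1 by ring, show N + 1 + m = N + m + 1 by ring]
      push_cast at this ⊢
      rw [eq_div_iff hn', add_mul, div_mul_cancel₀ _ hn']
      linarith
  simp_rw [h]
  have := (stC_tendsto n hn).comp (Filter.tendsto_add_atTop_nat m)
  simpa using (this.const_sub (stC n m)).div_const (n : ℝ)

lemma stC_tele_ennreal (n m : ℕ) (hn : 0 < n) :
    ∑' b : ℕ, (if m < b then ENNReal.ofReal (stC n b / b) else 0)
      = ENNReal.ofReal (stC n m / n) := by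
  have h := stC_tele n m hn
  rw [← h.tsum_eq, ENNReal.ofReal_tsum_of_nonneg
    (fun i => div_nonneg (stC_nonneg _ _) (Nat.cast_nonneg _)) h.summable]
  have key := Summable.sum_add_tsum_nat_add' (k := m + 1)
    (f := fun b : ℕ => if m < b then ENNReal.ofReal (stC n b / b) else 0) ENNReal.summable
  rw [← key, Finset.sum_eq_zero, zero_add]
  · refine tsum_congr fun i => ?_
    rw [if_pos (by omega)]
  · intro i hi
    rw [if_neg]
    have := Finset.mem_range.1 hi
    omega

lemma stG (n : ℕ) (hn : 0 < n) (j : ℕ) :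
    ∑' b : ℕ, ENNReal.ofReal (stW j b * stC n b) = ENNReal.ofReal (1 / (n : ℝ) ^ j) := by
  induction j with
  | zero =>
    rw [tsum_eq_single 0]
    · simp [stW_zero_zero, stC_zero]
    · intro b hb
      obtain ⟨k, rfl⟩ : ∃ k, b = k + 1 := ⟨b - 1, by omega⟩
      simp [stW_zero_succ]
  | succ j ih =>
    have h : ∀ b : ℕ, ENNReal.ofReal (stW (j + 1) b * stC n b)
        = ∑' t : ℕ, ENNReal.ofReal (stW j t) *
            (if t < b then ENNReal.ofReal (stC n b / b) else 0) := by
      intro b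
      rw [tsum_eq_sum (s := Finset.range b)]
      · rw [Finset.sum_congr rfl (g := fun t => ENNReal.ofReal (stW j t * (stC n b / b)))]
        · rw [← ENNReal.ofReal_sum_of_nonneg, ← Finset.sum_mul, ← stW_sum]
          · rcases Nat.eq_zero_or_pos b with rfl | hb
            · simp [stW_succ_zero]
            · congr 1
              have : (b : ℝ) ≠ 0 := by positivity
              field_simp
          · intro i _
            exact mul_nonneg (stW_nonneg _ _) (div_nonneg (stC_nonneg _ _) (Nat.cast_nonneg _))
        · intro t ht
          rw [if_pos (Finset.mem_range.1 ht), ENNReal.ofReal_mul (stW_nonneg _ _)]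
      · intro t ht
        rw [if_neg (by simpa using ht), mul_zero]
    simp_rw [h]
    rw [ENNReal.tsum_comm]
    simp_rw [ENNReal.tsum_mul_left, stC_tele_ennreal n _ hn]
    have h2 : ∀ t : ℕ, ENNReal.ofReal (stW j t) * ENNReal.ofReal (stC n t / n)
        = ENNReal.ofReal (stW j t * stC n t) * ENNReal.ofReal (1 / n) := by
      intro t
      rw [← ENNReal.ofReal_mul (stW_nonneg _ _),
        ← ENNReal.ofReal_mul (mul_nonneg (stW_nonneg _ _) (stC_nonneg _ _))]
      congr 1
      ring
    simp_rw [h2]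
    rw [ENNReal.tsum_mul_right, ih, ← ENNReal.ofReal_mul (by positivity)]
    congr 1
    rw [pow_succ]
    ring

lemma st_col (s : ℕ) :
    ∑' n : ℕ, ENNReal.ofReal (stC (n + 1) (s + 1) / ((n + 1 : ℕ) : ℝ))
      = ENNReal.ofReal (1 / ((s : ℝ) + 1)) := by
  have h := stC_tele (s + 1) 0 (by omega)
  rw [stC_zero] at h
  push_cast at h
  rw [← h.tsum_eq, ENNReal.ofReal_tsum_of_nonneg _ h.summable]
  · refine tsum_congr fun i => ?_
    rw [stC_symm]
    simp
  · intro i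
    exact div_nonneg (stC_nonneg _ _) (by positivity)

lemma st_main (p : ℕ) (hp : 0 < p) :
    ∑' s : ℕ, ENNReal.ofReal (stW p (s + 1) / ((s : ℝ) + 1))
      = ∑' n : ℕ, ENNReal.ofReal (1 / ((n : ℝ) + 1) ^ (p + 1)) := by
  obtain ⟨q, rfl⟩ : ∃ k, p = k + 1 := ⟨p - 1, by omega⟩
  have h1 : ∀ n : ℕ, ENNReal.ofReal (1 / ((n : ℝ) + 1) ^ (q + 1 + 1))
      = ∑' s : ℕ, ENNReal.ofReal (stW (q + 1) (s + 1)) *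
          ENNReal.ofReal (stC (n + 1) (s + 1) / ((n + 1 : ℕ) : ℝ)) := by
    intro n
    have := stG (n + 1) (by omega) (q + 1)
    rw [tsum_eq_zero_add' ENNReal.summable, stW_succ_zero] at this
    simp only [zero_mul, ENNReal.ofReal_zero, zero_add] at this
    have e : (1 / ((n : ℝ) + 1) ^ (q + 1 + 1))
        = 1 / (((n + 1 : ℕ) : ℝ)) ^ (q + 1) * (1 / ((n + 1 : ℕ) : ℝ)) := by
      push_cast
      rw [pow_succ _ (q + 1), one_div_mul_one_div]
    rw [e, ENNReal.ofReal_mul (by positivity), ← this, ← ENNReal.tsum_mul_right]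
    refine tsum_congr fun s => ?_
    rw [← ENNReal.ofReal_mul (stW_nonneg _ _),
      ← ENNReal.ofReal_mul (mul_nonneg (stW_nonneg _ _) (stC_nonneg _ _))]
    congr 1
    ring
  simp_rw [h1]
  rw [ENNReal.tsum_comm]
  refine tsum_congr fun s => ?_
  rw [ENNReal.tsum_mul_left, st_col, ← ENNReal.ofReal_mul (stW_nonneg _ _)]
  congr 1
  ring

/-- For every positive integer `p`, the series `Σ_{s=1}^∞ [s brack p]/(s·s!)` converges
and equals `ζ(p+1)`, where `[s brack p]` (the unsigned Stirling number of the first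
kind) is the coefficient of `x^p` in the rising factorial `x(x+1)⋯(x+s−1)`. -/
theorem hasSum_stirling_div (p : ℕ) (hp : 0 < p) :
    HasSum
      (fun s : ℕ =>
        ((((ascPochhammer ℕ (s + 1)).coeff p : ℝ) / (((s : ℝ) + 1) * ((s + 1)! : ℝ)) : ℝ) : ℂ))
      (riemannZeta ((p : ℂ) + 1)) := by
  have hf : ∀ s : ℕ, ((ascPochhammer ℕ (s + 1)).coeff p : ℝ) / (((s : ℝ) + 1) * ((s + 1)! : ℝ))
      = (ENNReal.ofReal (stW p (s + 1) / ((s : ℝ) + 1))).toReal := by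
    intro s
    rw [ENNReal.toReal_ofReal (div_nonneg (stW_nonneg _ _) (by positivity)), stW, div_div,
      mul_comm ((s : ℝ) + 1)]
  have hg : Summable (fun n : ℕ => 1 / ((n : ℝ) + 1) ^ (p + 1)) := by
    have := (summable_nat_add_iff 1).2
      (Real.summable_one_div_nat_pow (p := p + 1).2 (by omega))
    simpa using this
  have hz : riemannZeta ((p : ℂ) + 1) = ((∑' n : ℕ, 1 / ((n : ℝ) + 1) ^ (p + 1) : ℝ) : ℂ) := by
    rw [zeta_eq_tsum_one_div_nat_add_one_cpow (by simpa using hp)]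
    push_cast
    refine tsum_congr fun n => ?_
    rw [← Complex.cpow_natCast]
    push_cast
    rfl
  have hE := st_main p hp
  rw [← ENNReal.ofReal_tsum_of_nonneg (fun n => by positivity) hg] at hE
  have hs := ENNReal.hasSum_toReal (hE ▸ ENNReal.ofReal_ne_top)
  rw [← ENNReal.tsum_toReal_eq (fun _ => ENNReal.ofReal_ne_top), hE,
    ENNReal.toReal_ofReal (tsum_nonneg fun n => by positivity)] at hs
  rw [hz]
  simp_rw [hf]
  exact Complex.hasSum_ofReal.2 hs
end

section
/- For all integers p ≥ 0 and m ≥ 0, the quantity σ(p,m) equals p! · (m+1)! · Σ_{s=1}^{∞} [s brack p] · [s brack m+1] / (s!)², where [s brack k] is the unsigned Stirling number of the first kind. -/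
open scoped Nat

/-- The signed difference `d = (l₁ + … + l_p) − (l_{p+1} + … + l_{p+m})` for a
`(p+m)`-tuple of positive integers. -/
def sigDiff (p m : ℕ) (l : Fin (p + m) → ℕ+) : ℤ :=
  (∑ i : Fin p, ((l (Fin.castAdd m i) : ℕ) : ℤ)) - ∑ i : Fin m, ((l (Fin.natAdd p i) : ℕ) : ℤ)

/-- `σ(p,m)` is the sum, over all `(p+m)`-tuples `(l₁,…,l_{p+m})` of positive integers
with `d := (l₁+…+l_p) − (l_{p+1}+…+l_{p+m}) > 0`, of `1/((l₁⋯l_{p+m})·d)`. -/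
noncomputable def sigmaMT (p m : ℕ) : ℝ :=
  ∑' l : {l : Fin (p + m) → ℕ+ // 0 < sigDiff p m l},
    1 / ((∏ i, ((l.1 i : ℕ) : ℝ)) * ((sigDiff p m l.1 : ℤ) : ℝ))

open scoped ENNReal

/-- weight -/
noncomputable def wt (n : ℕ) : ℝ≥0∞ := ENNReal.ofReal ((n : ℝ)⁻¹)

lemma wt_zero : wt 0 = 0 := by simp [wt]

lemma wt_ne_top (n : ℕ) : wt n ≠ ⊤ := ENNReal.ofReal_ne_top

/-- sum over tuples with given sum -/
noncomputable def tupA (k s : ℕ) : ℝ≥0∞ :=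
  ∑' l : Fin k → ℕ+, if ∑ i, (l i : ℕ) = s then ∏ i, wt (l i) else 0

lemma tsum_cons (k : ℕ) (f : (Fin (k + 1) → ℕ+) → ℝ≥0∞) :
    ∑' l, f l = ∑' d : ℕ+, ∑' l : Fin k → ℕ+, f (Fin.cons d l) := by
  rw [← (Fin.consEquiv (fun _ => ℕ+)).tsum_eq, ENNReal.tsum_prod']
  rfl

/-- log series -/
noncomputable def logS : PowerSeries ℝ := PowerSeries.mk fun n => (n : ℝ)⁻¹

lemma tsum_pnat_wt (g : ℕ → ℝ≥0∞) : ∑' d : ℕ+, wt d * g d = ∑' d : ℕ, wt d * g d := by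
  have := tsum_subtype_eq_of_support_subset (f := fun d : ℕ => wt d * g d) (s := {n : ℕ | 0 < n})
    (by
      intro d hd
      rcases Nat.eq_zero_or_pos d with rfl | h
      · simp [wt_zero] at hd
      · exact h)
  rw [← this]
  rfl

lemma coeff_logS_pow_nonneg (k : ℕ) : ∀ s, 0 ≤ PowerSeries.coeff s (logS ^ k) := by
  induction k with
  | zero => intro s; simp only [pow_zero, PowerSeries.coeff_one]; split_ifs <;> norm_num
  | succ k ih =>
    intro s
    rw [pow_succ', PowerSeries.coeff_mul]
    refine Finset.sum_nonneg fun x _ => mul_nonneg ?_ (ih _)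
    simp [logS]

lemma tupA_eq (k : ℕ) : ∀ s, tupA k s = ENNReal.ofReal (PowerSeries.coeff s (logS ^ k)) := by
  induction k with
  | zero =>
    intro s
    simp only [tupA, pow_zero, PowerSeries.coeff_one, tsum_fintype]
    simp [eq_comm]
    split_ifs <;> simp
  | succ k ih =>
    intro s
    rw [tupA, tsum_cons]
    have h1 : ∀ d : ℕ+, (∑' l : Fin k → ℕ+,
        if ∑ i, ((Fin.cons d l : Fin (k + 1) → ℕ+) i : ℕ) = s then
          ∏ i, wt ((Fin.cons d l : Fin (k + 1) → ℕ+) i) else 0)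
        = wt d * (if (d : ℕ) ≤ s then tupA k (s - d) else 0) := by
      intro d
      simp only [Fin.sum_univ_succ, Fin.prod_univ_succ, Fin.cons_zero, Fin.cons_succ]
      split_ifs with h
      · rw [tupA, ← ENNReal.tsum_mul_left]
        refine tsum_congr fun l => ?_
        rw [mul_ite, mul_zero]
        refine if_congr (by omega) rfl rfl
      · rw [mul_zero, ENNReal.tsum_eq_zero]
        intro l
        rw [if_neg (by omega)]
    simp only [h1]
    rw [tsum_pnat_wt (fun d => if d ≤ s then tupA k (s - d) else 0)]
    rw [tsum_eq_sum (s := Finset.range (s + 1)) (by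
      intro d hd
      rw [if_neg (by simpa using hd), mul_zero])]
    rw [pow_succ', PowerSeries.coeff_mul, Finset.Nat.sum_antidiagonal_eq_sum_range_succ
      (fun a b => PowerSeries.coeff a logS * PowerSeries.coeff b (logS ^ k)),
      ENNReal.ofReal_sum_of_nonneg]
    · refine Finset.sum_congr rfl fun d hd => ?_
      rw [if_pos (by simpa [Nat.lt_succ_iff] using hd), ih, ENNReal.ofReal_mul (by simp [logS])]
      simp [logS, wt]
    · intro d _
      exact mul_nonneg (by simp [logS]) (coeff_logS_pow_nonneg _ _)

lemma logS_deriv : (1 - PowerSeries.X) * PowerSeries.derivative ℝ logS = 1 := by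
  have : PowerSeries.derivative ℝ logS = PowerSeries.mk 1 := by
    ext n
    rw [PowerSeries.coeff_derivative]
    simp only [logS, PowerSeries.coeff_mk, Pi.one_apply]
    push_cast
    field_simp
  rw [this, mul_comm]
  exact PowerSeries.mk_one_mul_one_sub_eq_one ℝ

lemma logS_rec (k s : ℕ) : ((s : ℝ) + 1) * PowerSeries.coeff (s + 1) (logS ^ (k + 1))
    = s * PowerSeries.coeff s (logS ^ (k + 1)) + (k + 1) * PowerSeries.coeff s (logS ^ k) := by
  have h : (1 - PowerSeries.X) * PowerSeries.derivative ℝ (logS ^ (k + 1))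
      = ((k : PowerSeries ℝ) + 1) * logS ^ k := by
    rw [Derivation.leibniz_pow]
    simp only [smul_eq_mul, nsmul_eq_mul, Nat.add_sub_cancel]
    push_cast
    linear_combination ((k : PowerSeries ℝ) + 1) * logS ^ k * logS_deriv
  have hc : ((k : PowerSeries ℝ) + 1) = PowerSeries.C ((k : ℝ) + 1) := by simp
  have h2 := congrArg (PowerSeries.coeff s) h
  rw [hc, PowerSeries.coeff_C_mul, sub_mul, one_mul, map_sub,
    PowerSeries.coeff_derivative] at h2
  cases s with
  | zero =>
    simp at h2 ⊢
    linarith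
  | succ s =>
    rw [PowerSeries.coeff_succ_X_mul, PowerSeries.coeff_derivative] at h2
    push_cast at h2 ⊢
    linarith

lemma coeff_logS_pow (s : ℕ) : ∀ k, PowerSeries.coeff s (logS ^ k) =
    (k ! : ℝ) * ((ascPochhammer ℕ s).coeff k : ℝ) / (s ! : ℝ) := by
  induction s with
  | zero =>
    intro k
    cases k with
    | zero => simp
    | succ k => simp [logS, Polynomial.coeff_one]
  | succ s ih =>
    intro k
    rw [ascPochhammer_succ_right]
    cases k with
    | zero =>
      have := ih 0
      simp only [Polynomial.mul_coeff_zero, pow_zero, PowerSeries.coeff_one]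
      cases s <;> simp [ascPochhammer_succ_left]
    | succ k =>
      have hr := logS_rec k s
      rw [ih, ih] at hr
      rw [mul_add, Polynomial.coeff_add, Polynomial.coeff_mul_X,
        ← Polynomial.C_eq_natCast, Polynomial.coeff_mul_C]
      rw [Nat.factorial_succ, Nat.factorial_succ] at *
      have : (s ! : ℝ) ≠ 0 := by positivity
      push_cast at *
      have h1 : (s : ℝ) + 1 ≠ 0 := by positivity
      field_simp at hr ⊢
      linarith

lemma tsum_append (p m : ℕ) (f : (Fin (p + m) → ℕ+) → ℝ≥0∞) :
    ∑' l, f l = ∑' l : Fin p → ℕ+, ∑' l' : Fin m → ℕ+, f (Fin.append l l') := by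
  rw [← (Fin.appendEquiv p m).tsum_eq, ENNReal.tsum_prod']
  rfl

lemma sum_AA (p m : ℕ) : ∑' s, tupA p s * tupA (m + 1) s =
    ∑' l : Fin p → ℕ+, ∑' l' : Fin m → ℕ+, ∑' d : ℕ+,
      if (d : ℕ) + ∑ i, (l' i : ℕ) = ∑ i, (l i : ℕ) then
        (∏ i, wt (l i)) * (wt d * ∏ i, wt (l' i)) else 0 := by
  simp only [tupA, ← ENNReal.tsum_mul_right]
  rw [ENNReal.tsum_comm]
  refine tsum_congr fun l => ?_
  rw [tsum_eq_single (∑ i, (l i : ℕ)) (by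
    intro s hs
    rw [if_neg hs.symm, zero_mul])]
  rw [if_pos rfl, tsum_cons, ← ENNReal.tsum_mul_left, ENNReal.tsum_comm]
  refine tsum_congr fun d => ?_
  rw [← ENNReal.tsum_mul_left]
  refine tsum_congr fun l' => ?_
  simp only [Fin.sum_univ_succ, Fin.prod_univ_succ, Fin.cons_zero, Fin.cons_succ, mul_ite, mul_zero]

lemma sigma_ennreal (p m : ℕ) :
    ∑' l : {l : Fin (p + m) → ℕ+ // 0 < sigDiff p m l},
      ENNReal.ofReal (1 / ((∏ i, ((l.1 i : ℕ) : ℝ)) * ((sigDiff p m l.1 : ℤ) : ℝ))) =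
    ∑' s, tupA p s * tupA (m + 1) s := by
  have := tsum_subtype {l : Fin (p + m) → ℕ+ | 0 < sigDiff p m l} (fun l =>
    ENNReal.ofReal (1 / ((∏ i, ((l i : ℕ) : ℝ)) * ((sigDiff p m l : ℤ) : ℝ))))
  refine this.trans ?_
  rw [tsum_append, sum_AA]
  refine tsum_congr fun l => tsum_congr fun l' => ?_
  have hd : sigDiff p m (Fin.append l l') = ((∑ i, (l i : ℕ) : ℕ) : ℤ) - (∑ i, (l' i : ℕ) : ℕ) := by
    simp [sigDiff]
  rw [Set.indicator_apply]
  split_ifs with h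
  · rw [Set.mem_ofPred_eq, hd] at h
    have hlt : 0 < (∑ i, (l i : ℕ)) - (∑ i, (l' i : ℕ)) := by omega
    obtain ⟨d0, hd0⟩ : ∃ d0 : ℕ+, (d0 : ℕ) = (∑ i, (l i : ℕ)) - (∑ i, (l' i : ℕ)) :=
      ⟨⟨_, hlt⟩, rfl⟩
    rw [tsum_eq_single d0 (by
      intro d hne
      rw [if_neg]
      intro he
      apply hne
      apply PNat.eq
      omega)]
    rw [if_pos (by omega), hd, hd0]
    have hw : ∀ {k : ℕ} (f : Fin k → ℕ+), ∏ i, wt (f i) =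
        ENNReal.ofReal (∏ i, ((f i : ℕ) : ℝ)⁻¹) := by
      intro k f
      rw [ENNReal.ofReal_prod_of_nonneg (fun i _ => by positivity)]
      rfl
    rw [hw, hw, wt, ← ENNReal.ofReal_mul (by positivity),
      ← ENNReal.ofReal_mul (Finset.prod_nonneg fun i _ => by positivity)]
    congr 1
    rw [Fin.prod_univ_add]
    simp only [Fin.append_left, Fin.append_right, Finset.prod_inv_distrib]
    rw [Nat.cast_sub (by omega)]
    push_cast
    rw [one_div, mul_inv, mul_inv]
    ring
  · rw [Set.mem_ofPred_eq, hd] at h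
    symm
    rw [ENNReal.tsum_eq_zero]
    intro d
    have := d.pos
    rw [if_neg (by omega)]

/-- For all `p, m ≥ 0`:
`σ(p,m) = p!·(m+1)!·Σ_{s=1}^∞ [s brack p]·[s brack m+1]/(s!)²`, where `[s brack k]`
(the unsigned Stirling number of the first kind) is the coefficient of `x^k` in the
rising factorial `x(x+1)⋯(x+s−1)`. -/
theorem sigmaMT_eq (p m : ℕ) :
    sigmaMT p m = (p ! : ℝ) * ((m + 1)! : ℝ) *
      ∑' s : ℕ,
        (((ascPochhammer ℕ (s + 1)).coeff p : ℝ) * ((ascPochhammer ℕ (s + 1)).coeff (m + 1) : ℝ))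
          / ((s + 1)! : ℝ) ^ 2 := by
  have hL : sigmaMT p m = (∑' s, tupA p s * tupA (m + 1) s).toReal := by
    rw [← sigma_ennreal, ENNReal.tsum_toReal_eq (fun _ => ENNReal.ofReal_ne_top)]
    refine tsum_congr fun l => ?_
    rw [ENNReal.toReal_ofReal]
    have : (0 : ℝ) < (sigDiff p m l.1 : ℤ) := by exact_mod_cast l.2
    have h2 : (0 : ℝ) ≤ ∏ i, ((l.1 i : ℕ) : ℝ) := Finset.prod_nonneg fun i _ => by positivity
    positivity
  have h0 : tupA (m + 1) 0 = 0 := by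
    rw [tupA_eq, coeff_logS_pow]
    simp [Polynomial.coeff_one]
  rw [hL, tsum_eq_zero_add' ENNReal.summable, h0, mul_zero, zero_add, ENNReal.tsum_toReal_eq,
    ← tsum_mul_left]
  · refine tsum_congr fun s => ?_
    rw [tupA_eq, tupA_eq, ENNReal.toReal_mul, ENNReal.toReal_ofReal (coeff_logS_pow_nonneg _ _),
      ENNReal.toReal_ofReal (coeff_logS_pow_nonneg _ _), coeff_logS_pow, coeff_logS_pow]
    ring
  · intro s
    rw [tupA_eq, tupA_eq]
    exact ENNReal.mul_ne_top ENNReal.ofReal_ne_top ENNReal.ofReal_ne_top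
end

section
/- For every positive integer n, the symmetrized Mordell–Tornheim value ζ̄_n = ζ̄_n(1,…,1) satisfies ζ̄_n = 2 · Σ_{p=0}^{n−1} C(n−1, p) · σ(p, n−1−p), where C(n−1,p) is the binomial coefficient. -/
open scoped ENNReal

/-- tsum of a product over all functions on `Fin k`. -/
theorem aux_tsum_pi (g : ℤ → ℝ≥0∞) (k : ℕ) :
    ∑' b : Fin k → ℤ, ∏ i, g (b i) = (∑' z, g z) ^ k := by
  induction k with
  | zero => simp
  | succ k ih =>
    rw [← (Fin.consEquiv (fun _ : Fin (k + 1) => ℤ)).tsum_eq, ENNReal.tsum_prod']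
    simp only [Fin.consEquiv_apply, Fin.prod_univ_succ, Fin.cons_zero, Fin.cons_succ]
    simp only [ENNReal.tsum_mul_left, ih]
    rw [ENNReal.tsum_mul_right, pow_succ, mul_comm]

theorem aux_pointwise (k : ℕ) (hk : 0 < k) (a : Fin (k + 1) → ℤ) (ha : ∀ i, a i ≠ 0) :
    ∃ j : Fin (k + 1), 1 / |∏ i, ((a i : ℤ) : ℝ) ^ 1| ≤
      ∏ i, |((a (j.succAbove i) : ℤ) : ℝ)| ^ (-(1 + 1 / (k : ℝ))) := by
  obtain ⟨j, -, hj⟩ := Finset.exists_max_image Finset.univ (fun i => |((a i : ℤ) : ℝ)|)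
    Finset.univ_nonempty
  refine ⟨j, ?_⟩
  have hpos : ∀ i, 0 < |((a i : ℤ) : ℝ)| := fun i => by
    have := ha i
    positivity
  have hk' : (0 : ℝ) < k := by exact_mod_cast hk
  simp only [pow_one, Finset.abs_prod]
  rw [Fin.prod_univ_succAbove _ j, one_div, mul_inv]
  have h1 : (|((a j : ℤ) : ℝ)|)⁻¹ ≤ ∏ i, |((a (j.succAbove i) : ℤ) : ℝ)| ^ (-(1 / (k : ℝ))) := by
    have : (|((a j : ℤ) : ℝ)|)⁻¹ = ∏ i : Fin k, |((a j : ℤ) : ℝ)| ^ (-(1 / (k : ℝ))) := by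
      rw [Finset.prod_const, Finset.card_univ, Fintype.card_fin, ← Real.rpow_natCast,
        ← Real.rpow_mul (abs_nonneg _), ← Real.rpow_neg_one]
      congr 1
      field_simp
    rw [this]
    apply Finset.prod_le_prod
    · intro i _
      positivity
    · intro i _
      apply Real.rpow_le_rpow_of_nonpos (hpos _) (hj _ (Finset.mem_univ _))
      rw [neg_nonpos]
      positivity
  calc _ ≤ (∏ i, |((a (j.succAbove i) : ℤ) : ℝ)| ^ (-(1 / (k : ℝ)))) *
        (∏ i, |((a (j.succAbove i) : ℤ) : ℝ)|)⁻¹ := by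
        gcongr
    _ = _ := by
        rw [← Finset.prod_inv_distrib, ← Finset.prod_mul_distrib]
        apply Finset.prod_congr rfl
        intro i _
        rw [← Real.rpow_neg_one, ← Real.rpow_add (hpos _)]
        congr 1
        ring

noncomputable def symE (n : ℕ) : ℝ≥0∞ :=
  ∑' a : {a : Fin n → ℤ // (∀ i, a i ≠ 0) ∧ ∑ i, a i = 0},
    ENNReal.ofReal (1 / |∏ i, ((a.1 i : ℝ)) ^ 1|)

theorem symE_ne_top (k : ℕ) : symE (k + 1) ≠ ∞ := by
  rcases Nat.eq_zero_or_pos k with rfl | hk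
  · have : IsEmpty {a : Fin (0 + 1) → ℤ // (∀ i, a i ≠ 0) ∧ ∑ i, a i = 0} := by
      constructor
      rintro ⟨a, h1, h2⟩
      simp at h2
      exact h1 0 h2
    simp [symE]
  have hk' : (0 : ℝ) < k := by exact_mod_cast hk
  set g : ℤ → ℝ≥0∞ := fun z => ENNReal.ofReal (|(z : ℝ)| ^ (-(1 + 1 / (k : ℝ)))) with hg
  have hgs : ∑' z, g z ≠ ∞ := by
    have : Summable fun z : ℤ => |(z : ℝ)| ^ (-(1 + 1 / (k : ℝ))) := by
      apply Real.summable_abs_int_rpow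
      have : 0 < 1 / (k : ℝ) := by positivity
      linarith
    exact this.tsum_ofReal_ne_top
  have hle : symE (k + 1) ≤ ∑ j : Fin (k + 1), (∑' z, g z) ^ k := by
    calc symE (k + 1) ≤ ∑' a : {a : Fin (k + 1) → ℤ // (∀ i, a i ≠ 0) ∧ ∑ i, a i = 0},
          ∑ j : Fin (k + 1), ∏ i, g (a.1 (j.succAbove i)) := by
          apply ENNReal.tsum_le_tsum
          rintro ⟨a, h1, h2⟩
          obtain ⟨j, hj⟩ := aux_pointwise k hk a h1
          refine le_trans (ENNReal.ofReal_le_ofReal hj) ?_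
          rw [ENNReal.ofReal_prod_of_nonneg (fun i _ => by positivity)]
          exact Finset.single_le_sum (f := fun j : Fin (k + 1) =>
            ∏ i, g (a (j.succAbove i))) (fun _ _ => zero_le) (Finset.mem_univ j)
      _ = ∑ j : Fin (k + 1), ∑' a : {a : Fin (k + 1) → ℤ // (∀ i, a i ≠ 0) ∧ ∑ i, a i = 0},
          ∏ i, g (a.1 (j.succAbove i)) := by
          rw [Summable.tsum_finsetSum (fun _ _ => ENNReal.summable)]
      _ ≤ _ := by
          apply Finset.sum_le_sum
          intro j _
          rw [← aux_tsum_pi]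
          refine ENNReal.tsum_comp_le_tsum_of_injective (f := fun (a : {a : Fin (k + 1) → ℤ //
            (∀ i, a i ≠ 0) ∧ ∑ i, a i = 0}) => fun i => a.1 (j.succAbove i)) ?_
            (fun b : Fin k → ℤ => ∏ i, g (b i))
          rintro ⟨a, h1, h2⟩ ⟨b, h3, h4⟩ hab
          have hab' : ∀ i, a (j.succAbove i) = b (j.succAbove i) := fun i => congrFun hab i
          rw [Fin.sum_univ_succAbove _ j] at h2 h4
          simp only [hab'] at h2
          ext i
          rcases Fin.eq_self_or_eq_succAbove j i with rfl | ⟨i, rfl⟩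
          · show a i = b i
            linarith
          · exact hab' i
  refine ne_top_of_le_ne_top ?_ hle
  rw [Finset.sum_const, nsmul_eq_mul]
  exact ENNReal.mul_ne_top (ENNReal.natCast_ne_top _) (ENNReal.pow_ne_top hgs)

/-- The summand attached to positive integers `l` and the set `s` of positive signs. -/
def sgnSum {k : ℕ} (s : Finset (Fin k)) (l : Fin k → ℕ+) : ℤ :=
  ∑ i, if i ∈ s then ((l i : ℕ) : ℤ) else -((l i : ℕ) : ℤ)

noncomputable def posTerm {k : ℕ} (s : Finset (Fin k)) (l : Fin k → ℕ+) : ℝ≥0∞ :=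
  if 0 < sgnSum s l then
    ENNReal.ofReal (1 / ((∏ i, ((l i : ℕ) : ℝ)) * ((sgnSum s l : ℤ) : ℝ))) else 0

noncomputable def sigmaE (p m : ℕ) : ℝ≥0∞ :=
  ∑' l : {l : Fin (p + m) → ℕ+ // 0 < sigDiff p m l},
    ENNReal.ofReal (1 / ((∏ i, ((l.1 i : ℕ) : ℝ)) * ((sigDiff p m l.1 : ℤ) : ℝ)))

theorem sigmaE_eq (p m : ℕ) : sigmaE p m = ∑' l : Fin (p + m) → ℕ+,
    if 0 < sigDiff p m l then
      ENNReal.ofReal (1 / ((∏ i, ((l i : ℕ) : ℝ)) * ((sigDiff p m l : ℤ) : ℝ))) else 0 := by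
  unfold sigmaE
  refine (tsum_subtype {l | 0 < sigDiff p m l} (fun l : Fin (p + m) → ℕ+ => ENNReal.ofReal
    (1 / ((∏ i, ((l i : ℕ) : ℝ)) * ((sigDiff p m l : ℤ) : ℝ))))).trans ?_
  apply tsum_congr
  intro l
  simp only [Set.indicator_apply, Set.mem_setOf_eq]

theorem tsum_posTerm {k p m : ℕ} (s : Finset (Fin k)) (hs : s.card = p) (hm : sᶜ.card = m) :
    ∑' l, posTerm s l = sigmaE p m := by
  rw [sigmaE_eq]
  let e : Fin (p + m) ≃ Fin k := finSumFinEquiv.symm.trans (finSumEquivOfFinset hs hm)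
  have e1 : ∀ i, e (Fin.castAdd m i) ∈ s := fun i => by simp [e]
  have e2 : ∀ i, e (Fin.natAdd p i) ∉ s := fun i => by
    have : e (Fin.natAdd p i) ∈ sᶜ := by
      simp only [e, Equiv.trans_apply, finSumFinEquiv_symm_apply_natAdd,
        finSumEquivOfFinset_inr]
      exact Finset.orderEmbOfFin_mem _ _ _
    simpa using this
  rw [← (e.arrowCongr (Equiv.refl ℕ+)).tsum_eq]
  apply tsum_congr
  intro l
  have hl : ∀ i, (e.arrowCongr (Equiv.refl ℕ+)) l (e i) = l i := fun i => by simp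
  have h1 : sgnSum s ((e.arrowCongr (Equiv.refl ℕ+)) l) = sigDiff p m l := by
    unfold sgnSum sigDiff
    rw [← e.sum_comp, Fin.sum_univ_add]
    simp only [hl, e1, e2, if_true, if_false, Finset.sum_neg_distrib]
    ring
  have h2 : ∏ i, (((e.arrowCongr (Equiv.refl ℕ+)) l i : ℕ) : ℝ) = ∏ i, ((l i : ℕ) : ℝ) := by
    rw [← e.prod_comp]
    simp only [hl]
  unfold posTerm
  rw [h1, h2]

/-- signs and absolute values give all tuples of nonzero integers -/
def mkTuple {k : ℕ} (x : Finset (Fin k) × (Fin k → ℕ+)) (i : Fin k) : ℤ :=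
  if i ∈ x.1 then ((x.2 i : ℕ) : ℤ) else -((x.2 i : ℕ) : ℤ)

theorem sum_mkTuple {k : ℕ} (x : Finset (Fin k) × (Fin k → ℕ+)) :
    ∑ i, mkTuple x i = sgnSum x.1 x.2 := rfl

theorem abs_mkTuple {k : ℕ} (x : Finset (Fin k) × (Fin k → ℕ+)) (i : Fin k) :
    |mkTuple x i| = ((x.2 i : ℕ) : ℤ) := by
  unfold mkTuple
  split_ifs <;> simp

theorem mkTuple_ne {k : ℕ} (x : Finset (Fin k) × (Fin k → ℕ+)) (i : Fin k) :
    mkTuple x i ≠ 0 := by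
  have := (x.2 i).pos
  unfold mkTuple
  split_ifs <;> omega

theorem mkTuple_inj {k : ℕ} : Function.Injective (mkTuple (k := k)) := by
  intro x y h
  have h2 : x.2 = y.2 := by
    ext i
    have := abs_mkTuple x i
    rw [h, abs_mkTuple] at this
    exact_mod_cast this.symm
  refine Prod.ext ?_ h2
  ext i
  have := congrFun h i
  have hp := (y.2 i).pos
  unfold mkTuple at this
  rw [h2] at this
  split_ifs at this <;> first | (exfalso; omega) | simp_all

theorem mkTuple_surj {k : ℕ} (a : Fin k → ℤ) (ha : ∀ i, a i ≠ 0) : ∃ x, mkTuple x = a := by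
  refine ⟨(Finset.univ.filter fun i => 0 < a i,
    fun i => ⟨(a i).natAbs, Int.natAbs_pos.2 (ha i)⟩), ?_⟩
  ext i
  unfold mkTuple
  simp only [Finset.mem_filter, Finset.mem_univ, true_and, PNat.mk_coe]
  split_ifs <;> omega

noncomputable def tupEquiv (k : ℕ) : {x : Finset (Fin k) × (Fin k → ℕ+) // sgnSum x.1 x.2 ≠ 0} ≃
    {a : Fin (k + 1) → ℤ // (∀ i, a i ≠ 0) ∧ ∑ i, a i = 0} :=
  Equiv.ofBijective (fun x => ⟨Fin.cons (-sgnSum x.1.1 x.1.2) (mkTuple x.1), by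
      intro i
      refine Fin.cases ?_ (fun i => ?_) i
      · simpa using x.2
      · simpa using mkTuple_ne x.1 i, by
      rw [Fin.sum_univ_succ]
      simp [sum_mkTuple]⟩) (by
    constructor
    · intro x y h
      simp only [Subtype.mk.injEq] at h
      exact Subtype.ext (mkTuple_inj (Fin.cons_injective2 h).2)
    · rintro ⟨a, h1, h2⟩
      obtain ⟨x, hx⟩ := mkTuple_surj (fun i => a (Fin.succ i)) (fun i => h1 _)
      have hs : sgnSum x.1 x.2 = - a 0 := by
        rw [← sum_mkTuple, hx]
        rw [Fin.sum_univ_succ] at h2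
        linarith
      refine ⟨⟨x, ?_⟩, ?_⟩
      · rw [hs]
        simpa using h1 0
      · ext i
        refine Fin.cases ?_ (fun i => ?_) i
        · simp [hs]
        · simp [hx])

theorem sgnSum_compl {k : ℕ} (s : Finset (Fin k)) (l : Fin k → ℕ+) :
    sgnSum sᶜ l = - sgnSum s l := by
  unfold sgnSum
  rw [← Finset.sum_neg_distrib]
  apply Finset.sum_congr rfl
  intro i _
  by_cases h : i ∈ s <;> simp [h]

theorem symE_eq (k : ℕ) : symE (k + 1) =
    2 * ∑ p ∈ Finset.range (k + 1), (k.choose p : ℝ≥0∞) * sigmaE p (k - p) := by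
  have hA : symE (k + 1) = ∑' x : Finset (Fin k) × (Fin k → ℕ+),
      (posTerm x.1 x.2 + posTerm x.1ᶜ x.2) := by
    unfold symE
    rw [← (tupEquiv k).tsum_eq]
    have : ∀ x : {x : Finset (Fin k) × (Fin k → ℕ+) // sgnSum x.1 x.2 ≠ 0},
        ENNReal.ofReal (1 / |∏ i, ((((tupEquiv k) x).1 i : ℤ) : ℝ) ^ 1|) =
        posTerm x.1.1 x.1.2 + posTerm x.1.1ᶜ x.1.2 := by
      rintro ⟨x, hx⟩
      have h1 : |∏ i, ((((tupEquiv k) ⟨x, hx⟩).1 i : ℤ) : ℝ) ^ 1| =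
          (∏ i, ((x.2 i : ℕ) : ℝ)) * |((sgnSum x.1 x.2 : ℤ) : ℝ)| := by
        simp only [pow_one, Finset.abs_prod]
        rw [Fin.prod_univ_succ, mul_comm]
        congr 1
        · apply Finset.prod_congr rfl
          intro i _
          have := abs_mkTuple x i
          have h : (tupEquiv k ⟨x, hx⟩).1 i.succ = mkTuple x i := rfl
          rw [h]
          exact_mod_cast this
        · have h : (tupEquiv k ⟨x, hx⟩).1 0 = -sgnSum x.1 x.2 := rfl
          rw [h]
          simp
      rw [h1]
      unfold posTerm
      rw [sgnSum_compl]
      simp only at hx ⊢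
      rcases lt_or_gt_of_ne hx with h | h
      · have h' : ((sgnSum x.1 x.2 : ℤ) : ℝ) < 0 := by exact_mod_cast h
        rw [if_neg (by omega), if_pos (by omega), abs_of_neg h']
        simp
      · have h' : 0 < ((sgnSum x.1 x.2 : ℤ) : ℝ) := by exact_mod_cast h
        rw [if_pos (by omega), if_neg (by omega), abs_of_pos h']
        simp
    rw [tsum_congr this]
    refine tsum_subtype_eq_of_support_subset (f := fun x : Finset (Fin k) × (Fin k → ℕ+) =>
      posTerm x.1 x.2 + posTerm x.1ᶜ x.2) (s := {x | sgnSum x.1 x.2 ≠ 0}) ?_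
    intro x hx hx0
    apply hx
    have hx0 : sgnSum x.1 x.2 = 0 := by simpa using hx0
    simp [posTerm, sgnSum_compl, hx0]
  have hB : ∀ s : Finset (Fin k), ∑' l, posTerm s l = sigmaE s.card (k - s.card) := fun s =>
    tsum_posTerm s rfl (by rw [Finset.card_compl, Fintype.card_fin])
  have hC : ∑ s : Finset (Fin k), sigmaE s.card (k - s.card) =
      ∑ p ∈ Finset.range (k + 1), (k.choose p : ℝ≥0∞) * sigmaE p (k - p) := by
    have := Finset.sum_powerset_apply_card (fun p => sigmaE p (k - p))
      (x := (Finset.univ : Finset (Fin k)))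
    simpa [nsmul_eq_mul] using this
  rw [hA, ENNReal.tsum_prod', tsum_fintype]
  simp only [ENNReal.tsum_add, Finset.sum_add_distrib]
  have hD : ∑ s : Finset (Fin k), ∑' l, posTerm sᶜ l = ∑ s : Finset (Fin k), ∑' l, posTerm s l :=
    Function.Bijective.sum_comp compl_bijective (fun s : Finset (Fin k) => ∑' l, posTerm s l)
  rw [hD, ← two_mul]
  simp only [hB, hC]

theorem sigmaMT_eq_s8 (p m : ℕ) : sigmaMT p m = (sigmaE p m).toReal := by
  unfold sigmaMT sigmaE
  rw [ENNReal.tsum_toReal_eq (fun _ => ENNReal.ofReal_ne_top)]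
  apply tsum_congr
  rintro ⟨l, hl⟩
  rw [ENNReal.toReal_ofReal]
  have : (0 : ℝ) < ((sigDiff p m l : ℤ) : ℝ) := by exact_mod_cast hl
  positivity

theorem symMT_eq (n : ℕ) : symMT n (fun _ => 1) = (symE n).toReal := by
  unfold symMT symE
  rw [ENNReal.tsum_toReal_eq (fun _ => ENNReal.ofReal_ne_top)]
  apply tsum_congr
  intro a
  rw [ENNReal.toReal_ofReal (by positivity)]

/-- For every positive integer `n`,
`ζ̄_n(1,…,1) = 2 · Σ_{p=0}^{n−1} C(n−1,p) · σ(p, n−1−p)`. -/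
theorem symMT_eq_sum_sigma (n : ℕ) (hn : 0 < n) :
    symMT n (fun _ => 1) =
      2 * ∑ p ∈ Finset.range n, ((n - 1).choose p : ℝ) * sigmaMT p (n - 1 - p) := by
  obtain ⟨k, rfl⟩ : ∃ k, n = k + 1 := ⟨n - 1, by omega⟩
  have hfin := symE_ne_top k
  rw [symMT_eq, symE_eq, ENNReal.toReal_mul, ENNReal.toReal_sum]
  · simp [sigmaMT_eq_s8]
  · intro p hp h
    apply hfin
    rw [symE_eq, ENNReal.sum_eq_top.2 ⟨p, hp, h⟩]
    simp
end

section
/- For every positive integer n, the symmetrized Mordell–Tornheim value ζ̄_n = ζ̄_n(1,…,1) satisfies ζ̄_n = n! · Σ_{s=1}^{∞} (1/(s!)²) · Σ_{p=0}^{n} [s brack p] · [s brack n−p], where [s brack k] is the unsigned Stirling number of the first kind; equivalently, the inner sum Σ_{p=0}^{n} [s brack p][s brack n−p] is the coefficient of x^n in the square of the rising factorial (x(x+1)⋯(x+s−1))². -/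
open scoped Nat

namespace SymMTProof

open PowerSeries Finset

/-- The series `Σ x^k / k`. -/
noncomputable def L : PowerSeries ℝ := PowerSeries.mk fun k => ((k : ℝ))⁻¹

lemma deriv_L : (1 - (X : PowerSeries ℝ)) * derivative ℝ L = 1 := by
  have h : derivative ℝ L = PowerSeries.mk (1 : ℕ → ℝ) := by
    ext k
    rw [coeff_derivative, L, coeff_mk, coeff_mk]
    push_cast
    simp only [Pi.one_apply]
    have : (k : ℝ) + 1 ≠ 0 := by positivity
    field_simp
  rw [h, mul_comm]
  exact mk_one_mul_one_sub_eq_one ℝ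

lemma coeff_rec (p u : ℕ) :
    coeff (u + 1) (L ^ (p + 1)) * (u + 1) =
      coeff u (L ^ (p + 1)) * u + (p + 1) * coeff u (L ^ p) := by
  have h : (1 - (X : PowerSeries ℝ)) * derivative ℝ (L ^ (p + 1)) = ((p + 1 : ℕ) : PowerSeries ℝ) * L ^ p := by
    rw [Derivation.leibniz_pow]
    simp only [Nat.add_sub_cancel, nsmul_eq_mul, smul_eq_mul]
    linear_combination (((p + 1 : ℕ) : PowerSeries ℝ) * L ^ p) * deriv_L
  have h2 := congrArg (coeff u) h
  rw [sub_mul, one_mul, map_sub, coeff_derivative, ← nsmul_eq_mul, map_nsmul, nsmul_eq_mul] at h2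
  cases u with
  | zero => simp at h2 ⊢; linarith
  | succ u =>
    rw [coeff_succ_X_mul, coeff_derivative] at h2
    push_cast at h2 ⊢
    linarith

lemma asc_rec (u p : ℕ) : (ascPochhammer ℕ (u + 1)).coeff (p + 1) =
    u * (ascPochhammer ℕ u).coeff (p + 1) + (ascPochhammer ℕ u).coeff p := by
  rw [ascPochhammer_succ_right, mul_add, Polynomial.coeff_add, Polynomial.coeff_mul_X,
    Polynomial.coeff_mul_natCast]
  simp; ring

lemma coeff_L_pow (u : ℕ) : ∀ p : ℕ,
    coeff u (L ^ p) = (p ! : ℝ) * ((ascPochhammer ℕ u).coeff p : ℝ) / (u ! : ℝ) := by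
  induction u with
  | zero =>
    intro p
    cases p with
    | zero => simp
    | succ p => simp [L, Polynomial.coeff_one]
  | succ u ih =>
    intro p
    cases p with
    | zero => simp [coeff_one, Polynomial.coeff_zero_eq_eval_zero]
    | succ p =>
      have h := coeff_rec p u
      rw [ih, ih] at h
      have h1 : (u : ℝ) + 1 ≠ 0 := by positivity
      have h2 : (u ! : ℝ) ≠ 0 := by positivity
      rw [eq_div_iff (by positivity), asc_rec, Nat.factorial_succ u]
      push_cast
      rw [← mul_assoc, h, Nat.factorial_succ p]
      push_cast
      field_simp

/-- The double coefficient. -/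
noncomputable def H (n u v : ℕ) : ℝ :=
  ∑ ij ∈ antidiagonal n, (n.choose ij.1 : ℝ) * (coeff u (L ^ ij.1) * coeff v (L ^ ij.2))

lemma coeff_nonneg (u p : ℕ) : 0 ≤ coeff u (L ^ p) := by
  rw [coeff_L_pow]; positivity

lemma H_nonneg (n u v : ℕ) : 0 ≤ H n u v :=
  Finset.sum_nonneg fun _ _ => mul_nonneg (by positivity)
    (mul_nonneg (coeff_nonneg _ _) (coeff_nonneg _ _))

lemma coeff_L_succ (u p : ℕ) : coeff u (L ^ (p + 1)) =
    ∑ k ∈ range (u + 1), (k : ℝ)⁻¹ * coeff (u - k) (L ^ p) := by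
  rw [pow_succ', coeff_mul, Finset.Nat.sum_antidiagonal_eq_sum_range_succ_mk]
  simp [L]

lemma H_succ (n u v : ℕ) : H (n + 1) u v =
    ∑ k ∈ range (u + 1), (k : ℝ)⁻¹ * H n (u - k) v +
    ∑ k ∈ range (v + 1), (k : ℝ)⁻¹ * H n u (v - k) := by
  unfold H
  rw [Finset.sum_antidiagonal_choose_succ_mul (fun i j => coeff u (L ^ i) * coeff v (L ^ j)) n,
    add_comm]
  congr 1
  · simp_rw [Finset.mul_sum]
    rw [Finset.sum_comm]
    refine Finset.sum_congr rfl fun ij hij => ?_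
    rw [coeff_L_succ, Finset.sum_mul, Finset.mul_sum]
    refine Finset.sum_congr rfl fun k _ => ?_
    rw [Nat.choose_symm_of_eq_add (mem_antidiagonal.1 hij).symm]
    ring
  · simp_rw [Finset.mul_sum]
    rw [Finset.sum_comm]
    refine Finset.sum_congr rfl fun ij hij => ?_
    rw [coeff_L_succ, Finset.mul_sum, Finset.mul_sum]
    refine Finset.sum_congr rfl fun k _ => ?_
    ring

lemma H_diag (n s : ℕ) : H n s s = (n ! : ℝ) * ((1 / (s ! : ℝ) ^ 2) *
        ∑ p ∈ Finset.range (n + 1),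
          ((ascPochhammer ℕ s).coeff p : ℝ) * ((ascPochhammer ℕ s).coeff (n - p) : ℝ)) := by
  rw [H, Finset.Nat.sum_antidiagonal_eq_sum_range_succ_mk, Finset.mul_sum, Finset.mul_sum]
  refine Finset.sum_congr rfl fun p hp => ?_
  have hp : p ≤ n := by simpa [Nat.lt_succ_iff] using hp
  simp only [coeff_L_pow]
  rw [← Nat.choose_mul_factorial_mul_factorial hp]
  push_cast
  have h2 : (s ! : ℝ) ≠ 0 := by positivity
  field_simp

open scoped ENNReal

/-- weight -/
noncomputable def wt (k : ℤ) : ℝ≥0∞ := ENNReal.ofReal (|(k : ℝ)|⁻¹)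

/-- restricted sum over tuples -/
noncomputable def G (n u v : ℕ) : ℝ≥0∞ :=
  ∑' a : Fin n → ℤ, if (∑ i, (a i).toNat = u ∧ ∑ i, (-a i).toNat = v) then ∏ i, wt (a i) else 0

lemma tsum_int (f : ℤ → ℝ≥0∞) (h0 : f 0 = 0) :
    ∑' k, f k = ∑' k : ℕ, f k + ∑' k : ℕ, f (-(k : ℤ)) := by
  have h1 := (HasSum.of_nat_of_neg_add_one (f := f) ENNReal.summable.hasSum
    ENNReal.summable.hasSum).tsum_eq
  rw [h1]
  congr 1
  rw [tsum_eq_zero_add' (f := fun k : ℕ => f (-(k : ℤ))) ENNReal.summable]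
  simp [h0]

lemma G_succ_aux (n u v : ℕ) : G (n + 1) u v =
    ∑' k : ℤ, if (k.toNat ≤ u ∧ (-k).toNat ≤ v) then
      wt k * G n (u - k.toNat) (v - (-k).toNat) else 0 := by
  unfold G
  rw [← (Fin.consEquiv (fun _ : Fin (n + 1) => ℤ)).tsum_eq, ENNReal.tsum_prod']
  refine tsum_congr fun k => ?_
  split_ifs with h
  · rw [← ENNReal.tsum_mul_left]
    refine tsum_congr fun a => ?_
    simp only [Fin.consEquiv_apply, Fin.sum_univ_succ, Fin.prod_univ_succ, Fin.cons_zero,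
      Fin.cons_succ, mul_ite, mul_zero]
    refine if_congr ?_ rfl rfl
    omega
  · refine ENNReal.tsum_eq_zero.2 fun a => ?_
    rw [if_neg]
    simp only [Fin.consEquiv_apply, Fin.sum_univ_succ, Fin.cons_zero, Fin.cons_succ]
    omega

lemma G_succ (n u v : ℕ) : G (n + 1) u v =
    ∑ k ∈ range (u + 1), wt k * G n (u - k) v +
    ∑ k ∈ range (v + 1), wt k * G n u (v - k) := by
  rw [G_succ_aux, tsum_int _ (by simp [wt])]
  congr 1
  · rw [tsum_eq_sum (s := range (u + 1))]
    · refine Finset.sum_congr rfl fun k hk => ?_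
      have : k ≤ u := by simpa [Nat.lt_succ_iff] using hk
      simp [this]
    · intro k hk
      have : ¬ k ≤ u := by simpa [Nat.lt_succ_iff] using hk
      simp [this]
  · rw [tsum_eq_sum (s := range (v + 1))]
    · refine Finset.sum_congr rfl fun k hk => ?_
      have : k ≤ v := by simpa [Nat.lt_succ_iff] using hk
      simp [this, wt]
    · intro k hk
      have : ¬ k ≤ v := by simpa [Nat.lt_succ_iff] using hk
      simp [this]

lemma wt_nat (k : ℕ) : wt k = ENNReal.ofReal ((k : ℝ)⁻¹) := by simp [wt]

lemma G_eq (n : ℕ) : ∀ u v : ℕ, G n u v = ENNReal.ofReal (H n u v) := by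
  induction n with
  | zero =>
    intro u v
    simp only [G, H, tsum_fintype]
    by_cases hu : u = 0 <;> by_cases hv : v = 0 <;>
      simp [coeff_one, hu, hv, eq_comm]
  | succ n ih =>
    intro u v
    have nn : ∀ k a b : ℕ, 0 ≤ (k : ℝ)⁻¹ * H n a b := fun k a b =>
      mul_nonneg (by positivity) (H_nonneg _ _ _)
    rw [G_succ, H_succ, ENNReal.ofReal_add (Finset.sum_nonneg fun _ _ => nn _ _ _)
      (Finset.sum_nonneg fun _ _ => nn _ _ _),
      ENNReal.ofReal_sum_of_nonneg (fun _ _ => nn _ _ _),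
      ENNReal.ofReal_sum_of_nonneg (fun _ _ => nn _ _ _)]
    simp only [ih, wt_nat]
    congr 1 <;>
    exact Finset.sum_congr rfl fun k _ => (ENNReal.ofReal_mul (by positivity)).symm

lemma total (n : ℕ) : ∑' a : {a : Fin n → ℤ // (∀ i, a i ≠ 0) ∧ ∑ i, a i = 0}, ∏ i, wt (a.1 i)
    = ∑' s : ℕ, G n s s := by
  unfold G
  rw [ENNReal.tsum_comm]
  refine (tsum_subtype {a : Fin n → ℤ | (∀ i, a i ≠ 0) ∧ ∑ i, a i = 0}
    (fun a => ∏ i, wt (a i))).trans ?_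
  refine tsum_congr fun a => ?_
  rw [Set.indicator_apply]
  have hz : ∑ i, a i = ((∑ i, (a i).toNat : ℕ) : ℤ) - ((∑ i, (-a i).toNat : ℕ) : ℤ) := by
    push_cast
    rw [← Finset.sum_sub_distrib]
    exact Finset.sum_congr rfl fun i _ => by omega
  by_cases h0 : ∀ i, a i ≠ 0
  · by_cases hs : ∑ i, a i = 0
    · rw [if_pos ⟨h0, hs⟩, tsum_eq_single (∑ i, (a i).toNat)]
      · rw [if_pos ⟨rfl, by omega⟩]
      · intro s hs'
        rw [if_neg]
        exact fun h => hs' h.1.symm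
    · rw [if_neg (fun h => hs h.2)]
      symm
      refine ENNReal.tsum_eq_zero.2 fun s => ?_
      rw [if_neg]
      omega
  · rw [if_neg (fun h => h0 h.1)]
    push Not at h0
    obtain ⟨i, hi⟩ := h0
    have : ∏ i, wt (a i) = 0 := Finset.prod_eq_zero (mem_univ i) (by simp [hi, wt])
    simp [this]

lemma symMT_eq (n : ℕ) : symMT n (fun _ => 1) = ∑' s : ℕ, H n s s := by
  have h := congrArg ENNReal.toReal (total n)
  simp only [G_eq] at h
  have ht : ∀ k, wt k ≠ ⊤ := fun k => ENNReal.ofReal_ne_top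
  rw [ENNReal.tsum_toReal_eq (fun _ => ENNReal.prod_ne_top fun _ _ => ht _),
    ENNReal.tsum_toReal_eq (fun _ => ENNReal.ofReal_ne_top)] at h
  simp only [ENNReal.toReal_ofReal (H_nonneg _ _ _)] at h
  rw [← h, symMT]
  refine tsum_congr fun a => ?_
  rw [ENNReal.toReal_prod]
  simp [wt, Finset.abs_prod]

end SymMTProof

/-- For every positive integer `n`,
`ζ̄_n(1,…,1) = n! · Σ_{s=1}^∞ (1/(s!)²) · Σ_{p=0}^n [s brack p]·[s brack n−p]`,
where `[s brack k]` is the unsigned Stirling number of the first kind, i.e. the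
coefficient of `x^k` in the rising factorial `x(x+1)⋯(x+s−1)`; moreover the inner
sum is the coefficient of `x^n` in the square of the rising factorial. -/
theorem symMT_eq_stirling_sum (n : ℕ) (hn : 0 < n) :
    symMT n (fun _ => 1) = (n ! : ℝ) *
      ∑' s : ℕ, (1 / ((s + 1)! : ℝ) ^ 2) *
        ∑ p ∈ Finset.range (n + 1),
          ((ascPochhammer ℕ (s + 1)).coeff p : ℝ) * ((ascPochhammer ℕ (s + 1)).coeff (n - p) : ℝ) ∧
    ∀ s : ℕ,
      ∑ p ∈ Finset.range (n + 1),
        (ascPochhammer ℕ s).coeff p * (ascPochhammer ℕ s).coeff (n - p)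
      = ((ascPochhammer ℕ s) ^ 2).coeff n := by
  refine ⟨?_, fun s => ?_⟩
  · rw [SymMTProof.symMT_eq, ← tsum_mul_left]
    have h0 : SymMTProof.H n 0 0 = 0 := by
      rw [SymMTProof.H_diag]
      rw [Finset.sum_eq_zero, mul_zero, mul_zero]
      intro p hp
      rcases Nat.eq_zero_or_pos p with rfl | hp'
      · simp [Polynomial.coeff_one, hn.ne']
      · simp [Polynomial.coeff_one, hp'.ne']
    have e : ∑' s : ℕ, SymMTProof.H n s s = ∑' s : ℕ, SymMTProof.H n (s + 1) (s + 1) := by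
      symm
      refine (Nat.succ_injective).tsum_eq (f := fun s => SymMTProof.H n s s) ?_
      intro s hs
      cases s with
      | zero => exact absurd h0 hs
      | succ s => exact ⟨s, rfl⟩
    rw [e]
    exact tsum_congr fun s => SymMTProof.H_diag n (s + 1)
  · rw [sq, Polynomial.coeff_mul, Finset.Nat.sum_antidiagonal_eq_sum_range_succ_mk]
end

section
/- For every real number x with 0 ≤ x < 1/2, the series Σ_{s=0}^{∞} ( (x)_s / s! )², where (x)_s = x(x+1)⋯(x+s−1) is the rising factorial (with (x)_0 = 1), converges and equals Γ(1−2x) / Γ(1−x)². -/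
open scoped Nat

namespace GaussAux

open Filter Topology

/-- `(x)_s / s!`. -/
noncomputable def p (x : ℝ) (s : ℕ) : ℝ := (ascPochhammer ℝ s).eval x / (s ! : ℝ)

/-- terms of `₂F₁(x,x;n+1;1)`. -/
noncomputable def a (x : ℝ) (n s : ℕ) : ℝ := p x s ^ 2 / ((n + s).choose s : ℝ)

lemma p_zero (x : ℝ) : p x 0 = 1 := by simp [p]

lemma p_succ (x : ℝ) (s : ℕ) : p x (s + 1) = p x s * ((x + s) / (s + 1)) := by
  have h : (s ! : ℝ) ≠ 0 := by positivity
  have h2 : (s : ℝ) + 1 ≠ 0 := by positivity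
  simp only [p, ascPochhammer_succ_eval, Nat.factorial_succ]
  push_cast
  field_simp

lemma p_nonneg {x : ℝ} (hx0 : 0 ≤ x) (s : ℕ) : 0 ≤ p x s := by
  induction s with
  | zero => simp [p_zero]
  | succ s ih => rw [p_succ]; positivity

lemma p_le {x : ℝ} (hx0 : 0 ≤ x) (hx : x < 1 / 2) (s : ℕ) : p x s ≤ ((s : ℝ) + 1) ^ (x - 1) := by
  induction s with
  | zero => simp [p_zero]
  | succ s ih =>
    rw [p_succ]
    have hs : (0 : ℝ) < (s : ℝ) + 1 := by positivity
    have key : (x + s) / ((s : ℝ) + 1) ≤ (((s : ℝ) + 2) / (s + 1)) ^ (x - 1) := by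
      have h1 := rpow_one_add_le_one_add_mul_self (s := 1 / ((s : ℝ) + 1)) (p := 1 - x)
        (by have : 0 < 1 / ((s : ℝ) + 1) := by positivity
            linarith) (by linarith) (by linarith)
      have e : (1 : ℝ) + 1 / (s + 1) = (s + 2) / (s + 1) := by field_simp; ring
      rw [e] at h1
      have hpos : (0 : ℝ) < ((s + 2) / (s + 1)) ^ (1 - x) := by positivity
      have e2 : (((s : ℝ) + 2) / (s + 1)) ^ (x - 1) = ((((s : ℝ) + 2) / (s + 1)) ^ (1 - x))⁻¹ := by
        rw [← Real.rpow_neg (by positivity)]; congr 1; ring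
      refine e2 ▸ (?_ : _ ≤ _)
      rw [← one_div, le_div_iff₀ hpos]
      calc (x + s) / ((s : ℝ) + 1) * (((s : ℝ) + 2) / (s + 1)) ^ (1 - x)
          ≤ (x + s) / ((s : ℝ) + 1) * (1 + (1 - x) * (1 / ((s : ℝ) + 1))) := by gcongr
        _ = 1 - ((1 - x) / ((s : ℝ) + 1)) ^ 2 := by field_simp; ring
        _ ≤ 1 := by linarith [sq_nonneg ((1 - x) / ((s : ℝ) + 1))]
    calc p x s * ((x + s) / (s + 1))
        ≤ ((s : ℝ) + 1) ^ (x - 1) * (((s : ℝ) + 2) / (s + 1)) ^ (x - 1) := by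
          gcongr
      _ = _ := by
          rw [← Real.mul_rpow (by positivity) (by positivity)]
          congr 1
          push_cast
          field_simp
          ring

lemma a_nonneg (x : ℝ) (n s : ℕ) : 0 ≤ a x n s := by unfold a; positivity

lemma a_zero (x : ℝ) (s : ℕ) : a x 0 s = p x s ^ 2 := by simp [a]

lemma a_s0 (x : ℝ) (n : ℕ) : a x n 0 = 1 := by simp [a, p_zero]

lemma a_le (x : ℝ) (n s : ℕ) : a x n s ≤ a x 0 s := by
  rw [a_zero]
  unfold a
  apply div_le_self (by positivity)
  have : 0 < (n + s).choose s := Nat.choose_pos (by omega)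
  exact_mod_cast this

lemma a_le' (x : ℝ) (n s : ℕ) : a x n (s + 1) ≤ a x 0 (s + 1) / (n + 1) := by
  rw [a_zero]
  unfold a
  apply div_le_div_of_nonneg_left (by positivity) (by positivity)
  have : n + 1 ≤ (n + (s + 1)).choose (s + 1) := by
    calc n + 1 = (n + 1).choose n := by simp
      _ ≤ (n + (s + 1)).choose n := Nat.choose_le_choose _ (by omega)
      _ = _ := Nat.choose_symm_add
  exact_mod_cast this

lemma a0_le {x : ℝ} (hx0 : 0 ≤ x) (hx : x < 1 / 2) (s : ℕ) :
    a x 0 s ≤ ((s : ℝ) + 1) ^ (2 * x - 2) := by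
  rw [a_zero]
  calc p x s ^ 2 ≤ (((s : ℝ) + 1) ^ (x - 1)) ^ 2 := by
        gcongr
        · exact p_nonneg hx0 s
        · exact p_le hx0 hx s
    _ = _ := by
      rw [← Real.rpow_natCast, ← Real.rpow_mul (by positivity)]
      congr 1; push_cast; ring

lemma a0_summable {x : ℝ} (hx0 : 0 ≤ x) (hx : x < 1 / 2) : Summable (a x 0) := by
  refine Summable.of_nonneg_of_le (a_nonneg x 0) (a0_le hx0 hx) ?_
  have h : Summable (fun n : ℕ => (n : ℝ) ^ (2 * x - 2)) :=
    Real.summable_nat_rpow.2 (by linarith)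
  have := (summable_nat_add_iff 1).2 h
  simpa using this

lemma a_summable {x : ℝ} (hx0 : 0 ≤ x) (hx : x < 1 / 2) (n : ℕ) : Summable (a x n) :=
  Summable.of_nonneg_of_le (a_nonneg x n) (a_le x n) (a0_summable hx0 hx)

lemma s_a_tendsto {x : ℝ} (hx0 : 0 ≤ x) (hx : x < 1 / 2) (n : ℕ) :
    Tendsto (fun s : ℕ => (s : ℝ) * a x n s) atTop (𝓝 0) := by
  have h : Tendsto (fun s : ℕ => ((s : ℝ) + 1) ^ (-(1 - 2 * x))) atTop (𝓝 0) :=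
    (tendsto_rpow_neg_atTop (by linarith)).comp
      (tendsto_atTop_add_const_right _ _ tendsto_natCast_atTop_atTop)
  refine squeeze_zero (fun s => mul_nonneg (by positivity) (a_nonneg x n s)) (fun s => ?_) h
  calc (s : ℝ) * a x n s ≤ ((s : ℝ) + 1) * ((s : ℝ) + 1) ^ (2 * x - 2) := by
        gcongr
        · exact a_nonneg x n s
        · linarith
        · exact (a_le x n s).trans (a0_le hx0 hx s)
    _ = _ := by
      rw [← Real.rpow_one_add' (by positivity) (by linarith)]
      congr 1; ring

lemma a_rec_s (x : ℝ) (n s : ℕ) :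
    a x n (s + 1) = a x n s * ((x + s) ^ 2 / ((s + 1) * (n + 1 + s))) := by
  have h : ((n + (s + 1)).choose (s + 1) : ℝ) * (s + 1) = (n + 1 + s) * ((n + s).choose s : ℝ) := by
    have := Nat.add_one_mul_choose_eq (n + s) s
    have h2 : ((n + s + 1 : ℕ) : ℝ) * ((n + s).choose s : ℝ)
      = ((n + s + 1).choose (s + 1) : ℝ) * ((s + 1 : ℕ) : ℝ) := by exact_mod_cast this
    push_cast at h2
    rw [← add_assoc, ← h2]; ring
  have h1 : ((n + s).choose s : ℝ) ≠ 0 := by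
    exact_mod_cast (Nat.choose_pos (by omega)).ne'
  have h3 : (s : ℝ) + 1 ≠ 0 := by positivity
  have h4 : (n : ℝ) + 1 + s ≠ 0 := by positivity
  have h' : ((n + (s + 1)).choose (s + 1) : ℝ) = (n + 1 + s) * ((n + s).choose s : ℝ) / (s + 1) := by
    rw [← h]; field_simp
  unfold a
  rw [p_succ, h']
  field_simp

lemma a_rec_n (x : ℝ) (n s : ℕ) :
    a x (n + 1) s = a x n s * ((n + 1) / (n + 1 + s)) := by
  induction s with
  | zero =>
    have h3 : (n : ℝ) + 1 ≠ 0 := by positivity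
    simp [a_s0, h3]
  | succ s ih =>
    rw [a_rec_s, ih, a_rec_s]
    have h3 : (s : ℝ) + 1 ≠ 0 := by positivity
    have h4 : (n : ℝ) + 1 + s ≠ 0 := by positivity
    have h5 : (n : ℝ) + 1 + 1 + s ≠ 0 := by positivity
    have h6 : (n : ℝ) + 1 + (s + 1) ≠ 0 := by positivity
    push_cast
    field_simp
    ring

lemma tele (x : ℝ) (n s : ℕ) :
    (n + 1 - 2 * x) * a x n s - (n + 1 - x) ^ 2 / (n + 1) * a x (n + 1) s
      = (s : ℝ) * a x n s - ((s + 1 : ℕ) : ℝ) * a x n (s + 1) := by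
  rw [a_rec_n, a_rec_s]
  have h3 : (s : ℝ) + 1 ≠ 0 := by positivity
  have h4 : (n : ℝ) + 1 + s ≠ 0 := by positivity
  have h5 : (n : ℝ) + 1 ≠ 0 := by positivity
  push_cast
  field_simp
  ring

lemma F_rec {x : ℝ} (hx0 : 0 ≤ x) (hx : x < 1 / 2) (n : ℕ) :
    (n + 1 - 2 * x) * ∑' s, a x n s = (n + 1 - x) ^ 2 / (n + 1) * ∑' s, a x (n + 1) s := by
  have h1 := ((a_summable hx0 hx n).hasSum.mul_left ((n : ℝ) + 1 - 2 * x)).sub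
    ((a_summable hx0 hx (n + 1)).hasSum.mul_left (((n : ℝ) + 1 - x) ^ 2 / (n + 1)))
  have h2 := h1.tendsto_sum_nat
  simp only [tele] at h2
  simp only [Finset.sum_range_sub' (fun s : ℕ => (s : ℝ) * a x n s)] at h2
  have h3 := (s_a_tendsto hx0 hx n).const_sub (((0 : ℕ) : ℝ) * a x n 0)
  have := tendsto_nhds_unique h2 h3
  simp at this
  linarith

lemma F_prod {x : ℝ} (hx0 : 0 ≤ x) (hx : x < 1 / 2) (n : ℕ) :
    ∑' s, a x 0 s = (∏ k ∈ Finset.range n,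
      ((1 - x + k) ^ 2 / ((1 + k) * (1 - 2 * x + k)))) * ∑' s, a x n s := by
  induction n with
  | zero => simp
  | succ n ih =>
    rw [ih, Finset.prod_range_succ, mul_assoc]
    congr 1
    have h := F_rec hx0 hx n
    have hn : (0 : ℝ) ≤ n := by positivity
    have h4 : 1 - 2 * x + n ≠ 0 := by linarith
    have h5 : 1 + (n : ℝ) ≠ 0 := by positivity
    have h6 : (n : ℝ) + 1 ≠ 0 := by positivity
    field_simp at h
    rw [div_mul_eq_mul_div, eq_div_iff (mul_ne_zero h5 h4)]
    linear_combination h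

lemma F_tendsto {x : ℝ} (hx0 : 0 ≤ x) (hx : x < 1 / 2) :
    Tendsto (fun n : ℕ => ∑' s, a x n s) atTop (𝓝 1) := by
  have e (n : ℕ) : ∑' s, a x n s = 1 + ∑' s, a x n (s + 1) := by
    rw [(a_summable hx0 hx n).tsum_eq_zero_add, a_s0]
  have hs (n : ℕ) : Summable (fun s => a x n (s + 1)) :=
    (summable_nat_add_iff 1).2 (a_summable hx0 hx n)
  have h0 : Tendsto (fun n : ℕ => (∑' s, a x 0 (s + 1)) / ((n : ℝ) + 1)) atTop (𝓝 0) :=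
    Tendsto.const_div_atTop
      (tendsto_atTop_add_const_right _ _ tendsto_natCast_atTop_atTop) _
  have h1 : Tendsto (fun n : ℕ => ∑' s, a x n (s + 1)) atTop (𝓝 0) := by
    refine squeeze_zero (fun n => tsum_nonneg fun s => a_nonneg x n _) (fun n => ?_) h0
    rw [← tsum_div_const]
    exact (hs n).tsum_le_tsum (a_le' x n) ((hs 0).div_const _)
  simp only [e]
  simpa using h1.const_add 1

lemma prod_eq {x : ℝ} (hx : x < 1 / 2) (n : ℕ) (hn : 0 < n) :
    (∏ k ∈ Finset.range (n + 1), ((1 - x + k) ^ 2 / ((1 + k) * (1 - 2 * x + k))))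
      = Real.GammaSeq (1 - 2 * x) n * Real.GammaSeq 1 n / Real.GammaSeq (1 - x) n ^ 2 := by
  have hn' : (0 : ℝ) < n := by exact_mod_cast hn
  have hp (y : ℝ) (hy : 0 < y) : (∏ k ∈ Finset.range (n + 1), (y + k)) ≠ 0 :=
    Finset.prod_ne_zero_iff.2 fun k _ => by positivity
  have p1 := hp (1 - x) (by linarith)
  have p2 := hp (1 - 2 * x) (by linarith)
  have p3 := hp 1 (by linarith)
  have hf : (n ! : ℝ) ≠ 0 := by positivity
  have hr : (n : ℝ) ^ (1 - 2 * x) * (n : ℝ) ^ (1 : ℝ) = ((n : ℝ) ^ (1 - x)) ^ 2 := by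
    rw [← Real.rpow_add hn', ← Real.rpow_natCast, ← Real.rpow_mul hn'.le]
    congr 1; push_cast; ring
  have hr0 : (n : ℝ) ^ (1 - x) ≠ 0 := by positivity
  rw [Finset.prod_div_distrib, Finset.prod_mul_distrib, Finset.prod_pow]
  unfold Real.GammaSeq
  rw [div_mul_div_comm, div_pow, mul_mul_mul_comm, hr]
  field_simp

end GaussAux

/-- For every real `x` with `0 ≤ x < 1/2`, the series `Σ_{s=0}^∞ ((x)_s / s!)²`,
where `(x)_s = x(x+1)⋯(x+s−1)` is the rising factorial, converges and equals
`Γ(1−2x)/Γ(1−x)²`. -/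
theorem hasSum_pochhammer_sq (x : ℝ) (hx0 : 0 ≤ x) (hx : x < 1 / 2) :
    HasSum (fun s : ℕ => ((ascPochhammer ℝ s).eval x / (s ! : ℝ)) ^ 2)
      (Real.Gamma (1 - 2 * x) / Real.Gamma (1 - x) ^ 2) := by
  have e : (fun s : ℕ => ((ascPochhammer ℝ s).eval x / (s ! : ℝ)) ^ 2) = GaussAux.a x 0 := by
    funext s
    rw [GaussAux.a_zero, GaussAux.p]
  rw [e]
  have hg : Real.Gamma (1 - x) ^ 2 ≠ 0 :=
    pow_ne_zero _ (Real.Gamma_pos_of_pos (by linarith)).ne'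
  have h1 := (((Real.GammaSeq_tendsto_Gamma (1 - 2 * x)).mul
    (Real.GammaSeq_tendsto_Gamma 1)).div ((Real.GammaSeq_tendsto_Gamma (1 - x)).pow 2) hg).mul
    ((Filter.tendsto_add_atTop_iff_nat 1).2 (GaussAux.F_tendsto hx0 hx))
  have h2 := h1.congr' (f₂ := fun _ => ∑' s, GaussAux.a x 0 s) (by
    filter_upwards [Filter.eventually_gt_atTop 0] with n hn
    rw [GaussAux.F_prod hx0 hx (n + 1), GaussAux.prod_eq hx n hn]
    rfl)
  have h3 := tendsto_nhds_unique h2 tendsto_const_nhds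
  rw [Real.Gamma_one, mul_one, mul_one] at h3
  rw [h3]
  exact (GaussAux.a_summable hx0 hx 0).hasSum
end

section
/- For every positive integer n, the symmetrized Mordell–Tornheim value ζ̄_n = ζ̄_n(1,…,1) equals the n-th derivative at x = 0 of the function F(x) = Γ(1−2x) / Γ(1−x)²; that is, ζ̄_n = F^{(n)}(0). -/
section MTproof
open scoped ENNReal

lemma MT_tsum_antidiag (F : ℕ × ℕ → ℝ≥0∞) :
    ∑' n, ∑ p ∈ Finset.HasAntidiagonal.antidiagonal n, F p = ∑' i, ∑' j, F (i, j) := by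
  rw [← ENNReal.tsum_prod, ← Finset.HasAntidiagonal.sigmaAntidiagonalEquivProd.tsum_eq (fun p : ℕ × ℕ => F (p.1, p.2)),
    ENNReal.tsum_sigma']
  refine tsum_congr fun n => ?_
  rw [← Finset.tsum_subtype]
  rfl

noncomputable def MTv (k : ℕ) : ℝ≥0∞ := if k = 0 then 0 else (k : ℝ≥0∞)⁻¹
noncomputable def MTw (k : ℤ) : ℝ≥0∞ := MTv k.natAbs
noncomputable def MTL : PowerSeries ℝ≥0∞ := PowerSeries.mk MTv

noncomputable def MTQ (s : ℤ) (f : PowerSeries ℝ≥0∞) : AddMonoid.End (ℤ → ℝ≥0∞) where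
  toFun g m := ∑' k : ℕ, PowerSeries.coeff k f * g (m + s * k)
  map_zero' := by ext m; simp
  map_add' g h := by ext m; simp [mul_add, ENNReal.tsum_add]

noncomputable def MTW : AddMonoid.End (ℤ → ℝ≥0∞) where
  toFun g m := ∑' k : ℤ, MTw k * g (m + k)
  map_zero' := by ext m; simp
  map_add' g h := by ext m; simp [mul_add, ENNReal.tsum_add]

lemma MTQ_apply (s : ℤ) (f : PowerSeries ℝ≥0∞) (g : ℤ → ℝ≥0∞) (m : ℤ) :
    MTQ s f g m = ∑' k : ℕ, PowerSeries.coeff k f * g (m + s * k) := rfl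
lemma MTW_apply (g : ℤ → ℝ≥0∞) (m : ℤ) :
    MTW g m = ∑' k : ℤ, MTw k * g (m + k) := rfl

lemma MTE_mul (A B : AddMonoid.End (ℤ → ℝ≥0∞)) (g : ℤ → ℝ≥0∞) : (A * B) g = A (B g) := rfl
lemma MTE_add (A B : AddMonoid.End (ℤ → ℝ≥0∞)) (g : ℤ → ℝ≥0∞) (m : ℤ) :
    (A + B) g m = A g m + B g m := rfl

lemma MTE_smul (n : ℕ) (A : AddMonoid.End (ℤ → ℝ≥0∞)) (g : ℤ → ℝ≥0∞) (m : ℤ) :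
    (n • A) g m = n * A g m := by
  induction n with
  | zero => simp
  | succ n ih => rw [succ_nsmul, MTE_add, ih]; push_cast; ring

lemma MTQ_mul (s : ℤ) (f h : PowerSeries ℝ≥0∞) : MTQ s (f * h) = MTQ s f * MTQ s h := by
  ext g m
  rw [MTE_mul, MTQ_apply, MTQ_apply]
  simp_rw [MTQ_apply, ← ENNReal.tsum_mul_left, PowerSeries.coeff_mul, Finset.sum_mul]
  rw [← MT_tsum_antidiag (fun p => PowerSeries.coeff p.1 f * (PowerSeries.coeff p.2 h * g (m + s * p.1 + s * p.2)))]
  refine tsum_congr fun n => Finset.sum_congr rfl fun p hp => ?_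
  rw [Finset.HasAntidiagonal.mem_antidiagonal] at hp
  rw [← hp, mul_assoc]
  congr 3
  push_cast; ring

lemma MTQ_one (s : ℤ) : MTQ s 1 = 1 := by
  ext g m
  rw [MTQ_apply, tsum_eq_single 0]
  · simp
  · intro k hk; simp [PowerSeries.coeff_one, hk]

lemma MTQ_pow (s : ℤ) (f : PowerSeries ℝ≥0∞) (p : ℕ) : MTQ s (f ^ p) = MTQ s f ^ p := by
  induction p with
  | zero => simp [MTQ_one]
  | succ p ih => rw [pow_succ, pow_succ, MTQ_mul, ih]

lemma MTQ_comm (s t : ℤ) (f h : PowerSeries ℝ≥0∞) : Commute (MTQ s f) (MTQ t h) := by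
  ext g m
  simp_rw [MTE_mul, MTQ_apply, ← ENNReal.tsum_mul_left]
  rw [ENNReal.tsum_comm]
  refine tsum_congr fun i => tsum_congr fun j => ?_
  rw [mul_left_comm, add_right_comm]

lemma MTW_eq : MTW = MTQ 1 MTL + MTQ (-1) MTL := by
  ext g m
  rw [MTE_add, MTQ_apply, MTQ_apply, MTW_apply]
  have h1 : HasSum (fun n : ℕ => MTw n * g (m + n)) (∑' k : ℕ, PowerSeries.coeff k MTL * g (m + 1 * k)) := by
    simp only [MTL, PowerSeries.coeff_mk, one_mul, MTw, Int.natAbs_natCast]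
    exact ENNReal.summable.hasSum
  have h2 : HasSum (fun n : ℕ => MTw (-(n + 1)) * g (m + -(n+1))) (∑' k : ℕ, PowerSeries.coeff k MTL * g (m + (-1) * k)) := by
    rw [tsum_eq_zero_add' ENNReal.summable]
    have : ∀ n : ℕ, ((-((n:ℤ) + 1)).natAbs) = n + 1 := by intro n; omega
    simp only [MTL, PowerSeries.coeff_mk, MTw, this]
    simp only [MTv]
    simp only [if_true, zero_mul, zero_add, neg_one_mul]
    push_cast
    exact ENNReal.summable.hasSum
  exact (HasSum.of_nat_of_neg_add_one (f := fun k : ℤ => MTw k * g (m + k)) h1 h2).tsum_eq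

lemma MTW_pow (n : ℕ) (g : ℤ → ℝ≥0∞) (m : ℤ) :
    (MTW ^ n) g m = ∑' a : Fin n → ℤ, (∏ i, MTw (a i)) * g (m + ∑ i, a i) := by
  induction n generalizing m with
  | zero => simp [tsum_fintype]
  | succ n ih =>
    rw [pow_succ', MTE_mul, MTW_apply]
    simp_rw [ih, ← ENNReal.tsum_mul_left]
    rw [← ENNReal.tsum_prod, ← (Fin.consEquiv (fun _ => ℤ)).tsum_eq]
    refine tsum_congr fun p => ?_
    simp [Fin.prod_univ_succ, Fin.sum_univ_succ, Fin.consEquiv, mul_assoc, add_assoc]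

noncomputable def MTc (p k : ℕ) : ℝ≥0∞ := PowerSeries.coeff k (MTL ^ p)

noncomputable def MTZ (n : ℕ) : ℝ≥0∞ := (MTW ^ n) (Pi.single 0 1) 0

lemma MTZ_eq (n : ℕ) : MTZ n = ∑ p ∈ Finset.HasAntidiagonal.antidiagonal n, (n.choose p.1 : ℝ≥0∞) * ∑' k, MTc p.1 k * MTc p.2 k := by
  have e : ∀ (s : Finset (ℕ × ℕ)) (F : ℕ × ℕ → AddMonoid.End (ℤ → ℝ≥0∞)) g m, (∑ p ∈ s, F p) g m = ∑ p ∈ s, F p g m := by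
    intro s F g m
    induction s using Finset.induction_on with
    | empty => simp
    | insert a s ha ih => rw [Finset.sum_insert ha, Finset.sum_insert ha, ← ih]; rfl
  rw [MTZ, MTW_eq, (MTQ_comm _ _ _ _).add_pow', e]
  refine Finset.sum_congr rfl fun p _ => ?_
  rw [← MTQ_pow, ← MTQ_pow, MTE_smul]
  congr 1
  rw [MTE_mul, MTQ_apply]
  refine tsum_congr fun k => ?_
  rw [MTQ_apply, tsum_eq_single k]
  · simp [MTc]
  · intro j hj
    rw [Pi.single_eq_of_ne, mul_zero]
    omega

lemma symMT_eq_Z (n : ℕ) : (∑' a : {a : Fin n → ℤ // (∀ i, a i ≠ 0) ∧ ∑ i, a i = 0},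
    1 / |∏ i, ((a.1 i : ℝ)) ^ 1|) = (MTZ n).toReal := by
  have : MTZ n = ∑' a : {a : Fin n → ℤ // (∀ i, a i ≠ 0) ∧ ∑ i, a i = 0},
     ENNReal.ofReal (1 / |∏ i, ((a.1 i : ℝ)) ^ 1|) := by
    rw [MTZ, MTW_pow]
    symm
    refine (tsum_subtype {a : Fin n → ℤ | (∀ i, a i ≠ 0) ∧ ∑ i, a i = 0} (fun a => ENNReal.ofReal (1 / |∏ i, ((a i : ℝ)) ^ 1|))).trans ?_
    refine tsum_congr fun a => ?_
    by_cases h0 : ∑ i, a i = 0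
    swap
    · rw [Set.indicator_of_notMem (by simp [h0]), zero_add, Pi.single_eq_of_ne h0, mul_zero]
    by_cases h1 : ∀ i, a i ≠ 0
    · rw [Set.indicator_of_mem (show a ∈ {a : Fin n → ℤ | (∀ i, a i ≠ 0) ∧ ∑ i, a i = 0} from ⟨h1, h0⟩), h0]
      simp only [pow_one, Finset.abs_prod, one_div, add_zero, Pi.single_eq_same, mul_one]
      rw [← Finset.prod_inv_distrib, ENNReal.ofReal_prod_of_nonneg (fun i _ => by positivity)]
      refine Finset.prod_congr rfl fun i _ => ?_
      have : (a i).natAbs ≠ 0 := by simpa using h1 i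
      rw [MTw, MTv, if_neg this, ENNReal.ofReal_inv_of_pos (by simpa using h1 i)]
      rw [← Int.cast_abs, Int.abs_eq_natAbs, Int.cast_natCast, ENNReal.ofReal_natCast]
    · rw [Set.indicator_of_notMem (by simp [h1])]
      push Not at h1
      obtain ⟨i, hi⟩ := h1
      rw [Finset.prod_eq_zero (Finset.mem_univ i) (by simp [hi, MTw, MTv]), zero_mul]
  rw [this, ENNReal.tsum_toReal_eq (fun _ => ENNReal.ofReal_ne_top)]
  refine tsum_congr fun a => ?_
  rw [ENNReal.toReal_ofReal (by positivity)]

lemma MTL_deriv : PowerSeries.derivative ℝ≥0∞ MTL = 1 + PowerSeries.X * PowerSeries.derivative ℝ≥0∞ MTL := by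
  have h : ∀ n : ℕ, PowerSeries.coeff n (PowerSeries.derivative ℝ≥0∞ MTL) = 1 := by
    intro n
    rw [PowerSeries.coeff_derivative, MTL, PowerSeries.coeff_mk, MTv, if_neg (by omega)]
    push_cast
    exact ENNReal.inv_mul_cancel (by simp) (by finiteness)
  ext n
  rw [h, map_add]
  cases n with
  | zero => simp
  | succ n => rw [PowerSeries.coeff_succ_X_mul, h]; simp [PowerSeries.coeff_one]

lemma MTc_rec (p k : ℕ) : ((k : ℝ≥0∞) + 1) * MTc (p + 1) (k + 1) = (p + 1) * MTc p k + k * MTc (p + 1) k := by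
  have h : PowerSeries.derivative ℝ≥0∞ (MTL ^ (p+1)) = (p+1 : ℕ) • MTL ^ p + PowerSeries.X * PowerSeries.derivative ℝ≥0∞ (MTL ^ (p+1)) := by
    have h1 : PowerSeries.derivative ℝ≥0∞ (MTL ^ (p+1)) = (p+1 : ℕ) • (MTL ^ p * PowerSeries.derivative ℝ≥0∞ MTL) := by
      rw [Derivation.leibniz_pow]; simp
    rw [h1]
    conv_lhs => rw [MTL_deriv]
    simp only [nsmul_eq_mul]
    ring
  have := congrArg (PowerSeries.coeff k) h
  rw [PowerSeries.coeff_derivative, map_add, map_nsmul, nsmul_eq_mul] at this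
  rw [mul_comm, MTc, this]
  push_cast
  congr 1
  cases k with
  | zero => simp
  | succ k => rw [PowerSeries.coeff_succ_X_mul, PowerSeries.coeff_derivative, MTc, mul_comm]; push_cast; rfl

lemma MTc_zero_left (k : ℕ) : MTc 0 k = if k = 0 then 1 else 0 := by
  simp [MTc, PowerSeries.coeff_one]

lemma MTc_zero_right (p : ℕ) : MTc p 0 = if p = 0 then 1 else 0 := by
  simp [MTc, MTL, MTv, zero_pow_eq]

noncomputable def MTy (x : ℝ≥0∞) (k : ℕ) : ℝ≥0∞ := ∑' p : ℕ, x ^ p * (p.factorial : ℝ≥0∞)⁻¹ * MTc p k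

lemma MTy_zero (x : ℝ≥0∞) : MTy x 0 = 1 := by
  rw [MTy, tsum_eq_single 0]
  · simp [MTc_zero_right]
  · intro p hp; simp [MTc_zero_right, hp]

lemma MTy_succ (x : ℝ≥0∞) (k : ℕ) : ((k : ℝ≥0∞) + 1) * MTy x (k + 1) = (x + k) * MTy x k := by
  have hA : ((k : ℝ≥0∞) + 1) * MTy x (k + 1) = ∑' p : ℕ, x ^ (p+1) * ((p+1).factorial : ℝ≥0∞)⁻¹ * ((k+1) * MTc (p+1) (k+1)) := by
    rw [MTy, tsum_eq_zero_add' ENNReal.summable, MTc_zero_left, if_neg (by omega), mul_zero, zero_add, ← ENNReal.tsum_mul_left]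
    exact tsum_congr fun p => by ring
  have hB : k * MTy x k = ∑' p : ℕ, x ^ (p+1) * ((p+1).factorial : ℝ≥0∞)⁻¹ * (k * MTc (p+1) k) := by
    rw [MTy, tsum_eq_zero_add' ENNReal.summable, mul_add, MTc_zero_left, ← ENNReal.tsum_mul_left]
    have : (k : ℝ≥0∞) * (x ^ 0 * ((Nat.factorial 0 : ℕ) : ℝ≥0∞)⁻¹ * if k = 0 then 1 else 0) = 0 := by
      by_cases hk : k = 0 <;> simp [hk]
    rw [this, zero_add]
    exact tsum_congr fun p => by ring
  rw [hA, add_mul, hB, MTy, ← ENNReal.tsum_mul_left, ← ENNReal.tsum_add]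
  refine tsum_congr fun p => ?_
  rw [MTc_rec, mul_add]
  congr 1
  have : (((p+1).factorial : ℕ) : ℝ≥0∞)⁻¹ * (p + 1) = (p.factorial : ℝ≥0∞)⁻¹ := by
    rw [Nat.factorial_succ, Nat.cast_mul, ENNReal.mul_inv (by simp) (by simp), mul_right_comm]
    push_cast
    rw [ENNReal.inv_mul_cancel (by simp) (by finiteness), one_mul]
  rw [← this]; ring

lemma MT_gen (x : ℝ≥0∞) : ∑' n : ℕ, x ^ n * (n.factorial : ℝ≥0∞)⁻¹ * MTZ n = ∑' k, MTy x k * MTy x k := by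
  simp_rw [MTZ_eq, Finset.mul_sum]
  have : ∀ n : ℕ, ∀ p ∈ Finset.HasAntidiagonal.antidiagonal n, x ^ n * (n.factorial : ℝ≥0∞)⁻¹ * ((n.choose p.1 : ℝ≥0∞) * ∑' k, MTc p.1 k * MTc p.2 k)
     = ∑' k, (x ^ p.1 * (p.1.factorial : ℝ≥0∞)⁻¹ * MTc p.1 k) * (x ^ p.2 * (p.2.factorial : ℝ≥0∞)⁻¹ * MTc p.2 k) := by
    intro n p hp
    rw [Finset.HasAntidiagonal.mem_antidiagonal] at hp
    subst hp
    have h1 : ((p.1 + p.2).factorial : ℝ≥0∞)⁻¹ * ((p.1 + p.2).choose p.1 : ℝ≥0∞) = (p.1.factorial : ℝ≥0∞)⁻¹ * (p.2.factorial : ℝ≥0∞)⁻¹ := by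
      have h2 := Nat.add_choose_mul_factorial_mul_factorial p.1 p.2
      rw [← Nat.choose_symm_add] at h2
      rw [← h2]
      have h3 : ((p.1 + p.2).choose p.1 : ℝ≥0∞) ≠ 0 := by
        exact_mod_cast (Nat.choose_pos (by omega)).ne'
      push_cast
      rw [mul_assoc, ENNReal.mul_inv (by left; exact h3) (by simp), ENNReal.mul_inv (by simp) (by simp), mul_right_comm,
        ENNReal.inv_mul_cancel h3 (by simp), one_mul]
    rw [← mul_assoc, mul_assoc (x ^ _), h1, ← ENNReal.tsum_mul_left]
    exact tsum_congr fun k => by ring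
  rw [tsum_congr fun n => Finset.sum_congr rfl (this n),
    MT_tsum_antidiag (fun p => ∑' k, (x ^ p.1 * (p.1.factorial : ℝ≥0∞)⁻¹ * MTc p.1 k) * (x ^ p.2 * (p.2.factorial : ℝ≥0∞)⁻¹ * MTc p.2 k))]
  simp_rw [MTy]
  simp_rw [← ENNReal.tsum_mul_right, ← ENNReal.tsum_mul_left]
  conv_rhs => rw [ENNReal.tsum_comm]
  refine tsum_congr fun i => ?_
  rw [ENNReal.tsum_comm]

open MeasureTheory in
lemma MT_beta {a b : ℝ} (ha : 0 < a) (hb : 0 < b) :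
    ∫⁻ t in Set.Ioo (0:ℝ) 1, ENNReal.ofReal (t ^ (a - 1) * (1 - t) ^ (b - 1)) =
      ENNReal.ofReal (ProbabilityTheory.beta a b) := by
  have hB := ProbabilityTheory.beta_pos ha hb
  have h := ProbabilityTheory.lintegral_betaPDF_eq_one ha hb
  rw [ProbabilityTheory.lintegral_betaPDF] at h
  rw [← mul_one (ENNReal.ofReal (ProbabilityTheory.beta a b)), ← h, ← lintegral_const_mul' _ _ ENNReal.ofReal_ne_top]
  refine lintegral_congr fun t => ?_
  rw [← ENNReal.ofReal_mul hB.le]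
  congr 1
  field_simp

noncomputable def MTu (x : ℝ) (k : ℕ) : ℝ := Ring.choose (x + k - 1) k

lemma MTu_eval (x : ℝ) (k : ℕ) : (k.factorial : ℝ) * MTu x k = (ascPochhammer ℝ k).eval x := by
  rw [MTu, ← Ring.multichoose_eq, ← nsmul_eq_mul, Ring.factorial_nsmul_multichoose_eq_ascPochhammer,
    Polynomial.ascPochhammer_smeval_eq_eval]

lemma MTu_zero (x : ℝ) : MTu x 0 = 1 := by simp [MTu]

lemma MTu_succ (x : ℝ) (k : ℕ) : ((k : ℝ) + 1) * MTu x (k + 1) = (x + k) * MTu x k := by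
  have h1 := MTu_eval x k
  have h2 := MTu_eval x (k + 1)
  rw [ascPochhammer_succ_eval, ← h1, Nat.factorial_succ] at h2
  have h3 : (k.factorial : ℝ) ≠ 0 := by positivity
  apply mul_left_cancel₀ h3
  push_cast at h2
  linear_combination h2

lemma MTu_nonneg {x : ℝ} (hx : 0 ≤ x) (k : ℕ) : 0 ≤ MTu x k := by
  induction k with
  | zero => simp [MTu_zero]
  | succ k ih =>
    have h := MTu_succ x k
    have : 0 ≤ ((k : ℝ) + 1) * MTu x (k + 1) := by rw [h]; positivity
    exact nonneg_of_mul_nonneg_right this (by positivity)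

lemma MTy_eq {x : ℝ} (hx : 0 ≤ x) (k : ℕ) : MTy (ENNReal.ofReal x) k = ENNReal.ofReal (MTu x k) := by
  induction k with
  | zero => simp [MTy_zero, MTu_zero]
  | succ k ih =>
    have h1 := MTy_succ (ENNReal.ofReal x) k
    have h2 := congrArg ENNReal.ofReal (MTu_succ x k)
    rw [ENNReal.ofReal_mul (by positivity), ENNReal.ofReal_mul (by positivity),
      ENNReal.ofReal_add (by positivity) (by positivity), ENNReal.ofReal_add (by positivity) (by positivity),
      ENNReal.ofReal_natCast, ENNReal.ofReal_one, ← ih, ← h1] at h2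
    exact ((ENNReal.mul_right_inj (by simp) (by finiteness)).1 h2).symm

lemma MTu_gamma {x : ℝ} (hx : 0 < x) (k : ℕ) :
    Real.Gamma x * MTu x k = Real.Gamma (x + k) / k.factorial := by
  induction k with
  | zero => simp [MTu_zero]
  | succ k ih =>
    have h := MTu_succ x k
    rw [Nat.factorial_succ]
    push_cast
    rw [← add_assoc, Real.Gamma_add_one (by positivity)]
    have h4 : MTu x (k + 1) = (x + k) * MTu x k / (k + 1) := by
      rw [eq_div_iff (by positivity)]; linarith
    rw [h4]
    field_simp at ih ⊢
    linear_combination ih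

lemma MTu_hasSum (x : ℝ) {t : ℝ} (h0 : 0 ≤ t) (h1 : t < 1) :
    HasSum (fun k => MTu x k * t ^ k) ((1 - t) ^ (-x)) := by
  have h := (Real.one_div_one_sub_rpow_hasFPowerSeriesOnBall_zero x).hasSum (y := t)
    (by simp [abs_of_nonneg h0, h1, enorm_eq_nnnorm, ← NNReal.coe_lt_coe])
  simp only [zero_add, FormalMultilinearSeries.ofScalars_apply_eq, smul_eq_mul] at h
  rw [Real.rpow_neg (by linarith), ← one_div]
  exact h

open MeasureTheory in
lemma MT_gauss {x : ℝ} (hx : 0 < x) (hx2 : x < 1 / 2) :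
    ∑' k, MTy (ENNReal.ofReal x) k * MTy (ENNReal.ofReal x) k =
      ENNReal.ofReal (Real.Gamma (1 - 2 * x) / Real.Gamma (1 - x) ^ 2) := by
  have g1 : 0 < Real.Gamma x := Real.Gamma_pos_of_pos hx
  have g2 : 0 < Real.Gamma (1 - x) := Real.Gamma_pos_of_pos (by linarith)
  have g3 : 0 < Real.Gamma (1 - 2 * x) := Real.Gamma_pos_of_pos (by linarith)
  have hC : 0 < Real.Gamma x * Real.Gamma (1 - x) := by positivity
  have key : ENNReal.ofReal (Real.Gamma x * Real.Gamma (1 - x)) * ∑' k, MTy (ENNReal.ofReal x) k * MTy (ENNReal.ofReal x) k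
      = ENNReal.ofReal (ProbabilityTheory.beta x (1 - 2 * x)) := by
    rw [← MT_beta hx (by linarith), ← ENNReal.tsum_mul_left]
    have e1 : ∀ k : ℕ, ENNReal.ofReal (Real.Gamma x * Real.Gamma (1 - x)) * (MTy (ENNReal.ofReal x) k * MTy (ENNReal.ofReal x) k)
      = ∫⁻ t in Set.Ioo (0:ℝ) 1, ENNReal.ofReal (MTu x k) * ENNReal.ofReal (t ^ (x + k - 1) * (1 - t) ^ ((1 - x) - 1)) := by
      intro k
      have hu := MTu_nonneg hx.le k
      rw [lintegral_const_mul' _ _ ENNReal.ofReal_ne_top, MT_beta (by positivity) (by linarith), MTy_eq hx.le,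
        ← ENNReal.ofReal_mul hu, ← ENNReal.ofReal_mul hC.le, ← ENNReal.ofReal_mul hu]
      congr 1
      rw [ProbabilityTheory.beta, show x + k + (1 - x) = (k : ℝ) + 1 by ring, Real.Gamma_nat_eq_factorial]
      have := MTu_gamma hx k
      rw [mul_div_right_comm, ← this]
      ring
    rw [tsum_congr e1, ← lintegral_tsum (fun k => by fun_prop)]
    refine setLIntegral_congr_fun measurableSet_Ioo fun t ht => ?_
    obtain ⟨ht0, ht1⟩ := ht
    have ht1' : 0 < 1 - t := by linarith
    have hs := (MTu_hasSum x ht0.le ht1).mul_right (t ^ (x - 1) * (1 - t) ^ (-x))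
    have e2 : ∀ k : ℕ, ENNReal.ofReal (MTu x k) * ENNReal.ofReal (t ^ (x + k - 1) * (1 - t) ^ ((1 - x) - 1))
        = ENNReal.ofReal (MTu x k * t ^ k * (t ^ (x - 1) * (1 - t) ^ (-x))) := by
      intro k
      rw [← ENNReal.ofReal_mul (MTu_nonneg hx.le k)]
      congr 1
      rw [show x + k - 1 = (x - 1) + k by ring, Real.rpow_add_natCast ht0.ne', show 1 - x - 1 = -x by ring]
      ring
    simp only [e2]
    rw [← ENNReal.ofReal_tsum_of_nonneg (fun k => ?_) hs.summable, hs.tsum_eq]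
    · congr 1
      rw [show 1 - 2 * x - 1 = -x + -x by ring, Real.rpow_add ht1']
      ring
    · have := MTu_nonneg hx.le k
      positivity
  have k2 : ENNReal.ofReal (ProbabilityTheory.beta x (1 - 2 * x)) = ENNReal.ofReal (Real.Gamma x * Real.Gamma (1 - x)) *
      ENNReal.ofReal (Real.Gamma (1 - 2 * x) / Real.Gamma (1 - x) ^ 2) := by
    rw [← ENNReal.ofReal_mul hC.le, ProbabilityTheory.beta, show x + (1 - 2 * x) = 1 - x by ring]
    congr 1
    field_simp
  rw [k2] at key
  exact (ENNReal.mul_right_inj (by simpa using hC) ENNReal.ofReal_ne_top).1 key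

lemma MT_Z_ne_top (n : ℕ) : MTZ n ≠ ⊤ := by
  have h := MT_gen (ENNReal.ofReal (1/4))
  rw [MT_gauss (by norm_num) (by norm_num)] at h
  have h2 := ENNReal.ne_top_of_tsum_ne_top (h ▸ ENNReal.ofReal_ne_top) n
  intro h3
  rw [h3, ENNReal.mul_top] at h2
  · exact h2 rfl
  · refine mul_ne_zero (pow_ne_zero _ (by simp)) (by simp)

lemma MT_hasSum {x : ℝ} (hx : 0 < x) (hx2 : x < 1 / 2) :
    HasSum (fun n : ℕ => (MTZ n).toReal / n.factorial * x ^ n)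
      (Real.Gamma (1 - 2 * x) / Real.Gamma (1 - x) ^ 2) := by
  have h := MT_gen (ENNReal.ofReal x)
  rw [MT_gauss hx hx2] at h
  have g2 : 0 < Real.Gamma (1 - x) := Real.Gamma_pos_of_pos (by linarith)
  have g3 : 0 < Real.Gamma (1 - 2 * x) := Real.Gamma_pos_of_pos (by linarith)
  have h2 := ENNReal.hasSum_toReal (h ▸ ENNReal.ofReal_ne_top)
  have h3 : ∀ n : ℕ, ENNReal.ofReal x ^ n * (n.factorial : ℝ≥0∞)⁻¹ * MTZ n ≠ ⊤ :=
    fun n => ENNReal.ne_top_of_tsum_ne_top (h ▸ ENNReal.ofReal_ne_top) n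
  rw [← ENNReal.tsum_toReal_eq h3, h, ENNReal.toReal_ofReal (by positivity)] at h2
  convert h2 using 2 with n
  rw [ENNReal.toReal_mul, ENNReal.toReal_mul, ENNReal.toReal_pow, ENNReal.toReal_ofReal hx.le, ENNReal.toReal_inv,
    ENNReal.toReal_natCast]
  ring

lemma MT_Gamma_analytic {s : ℝ} (hs : 0 < s) : AnalyticAt ℝ Real.Gamma s := by
  have h : AnalyticAt ℂ Complex.Gamma s := by
    rw [Complex.analyticAt_iff_eventually_differentiableAt]
    have : ∀ᶠ z : ℂ in nhds (s : ℂ), 0 < z.re :=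
      Complex.continuous_re.continuousAt.eventually (lt_mem_nhds (by simpa using hs))
    filter_upwards [this] with z hz
    refine Complex.differentiableAt_Gamma z fun m hm => ?_
    rw [hm] at hz
    simp at hz
    exact absurd hz (by have : (0:ℝ) ≤ m := by positivity
                        linarith)
  exact h.re_ofReal

lemma MT_F_analytic :
    AnalyticAt ℝ (fun x : ℝ => Real.Gamma (1 - 2 * x) / Real.Gamma (1 - x) ^ 2) 0 := by
  have h1 : AnalyticAt ℝ (fun x : ℝ => Real.Gamma (1 - 2 * x)) 0 :=
    AnalyticAt.fun_comp (g := Real.Gamma) (f := fun x : ℝ => 1 - 2 * x) (MT_Gamma_analytic (by norm_num)) (by fun_prop)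
  have h2 : AnalyticAt ℝ (fun x : ℝ => Real.Gamma (1 - x)) 0 :=
    AnalyticAt.fun_comp (g := Real.Gamma) (f := fun x : ℝ => 1 - x) (MT_Gamma_analytic (by norm_num)) (by fun_prop)
  exact h1.div (h2.pow 2) (by simp)

lemma MT_final (n : ℕ) : (MTZ n).toReal =
      iteratedDeriv n (fun x : ℝ => Real.Gamma (1 - 2 * x) / Real.Gamma (1 - x) ^ 2) 0 := by
  set F := (fun x : ℝ => Real.Gamma (1 - 2 * x) / Real.Gamma (1 - x) ^ 2) with hF
  set c : ℕ → ℝ := fun n => (MTZ n).toReal / n.factorial with hc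
  set P := FormalMultilinearSeries.ofScalars ℝ c with hP
  have hr : ((1/4 : NNReal) : ℝ≥0∞) ≤ P.radius := by
    apply FormalMultilinearSeries.le_radius_of_summable
    refine (MT_hasSum (x := 1/4) (by norm_num) (by norm_num)).summable.congr fun n => ?_
    rw [hP, FormalMultilinearSeries.ofScalars_norm, Real.norm_of_nonneg (by positivity)]
    simp [hc]
  have hr0 : 0 < P.radius := lt_of_lt_of_le (by simp) hr
  have hG : HasFPowerSeriesAt P.sum P 0 := (P.hasFPowerSeriesOnBall hr0).hasFPowerSeriesAt
  have hfreq : ∃ᶠ z in nhdsWithin (0:ℝ) {0}ᶜ, P.sum z = F z := by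
    have h1 : ∀ᶠ z in nhdsWithin (0:ℝ) (Set.Ioi 0), P.sum z = F z := by
      filter_upwards [Ioo_mem_nhdsGT (show (0:ℝ) < 1/2 by norm_num)] with z hz
      refine Eq.trans ?_ (MT_hasSum hz.1 hz.2).tsum_eq
      rw [FormalMultilinearSeries.sum]
      refine tsum_congr fun n => ?_
      rw [hP, FormalMultilinearSeries.ofScalars_apply_eq, smul_eq_mul]
    exact h1.frequently.filter_mono (nhdsWithin_mono _ (fun z hz => ne_of_gt hz))
  have heq := (hG.analyticAt.frequently_eq_iff_eventually_eq MT_F_analytic).1 hfreq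
  have h1 : HasFPowerSeriesAt F P 0 := hG.congr heq
  have h2 := MT_F_analytic.hasFPowerSeriesAt
  have h3 := h1.eq_formalMultilinearSeries h2
  have h4 := congrFun (FormalMultilinearSeries.ofScalars_series_injective ℝ ℝ h3) n
  have h5 : (n.factorial : ℝ) ≠ 0 := by positivity
  simp only [hc] at h4
  exact (div_left_inj' h5).1 h4

end MTproof

/-- For every positive integer `n`, `ζ̄_n(1,…,1)` equals the `n`-th derivative at
`x = 0` of `F(x) = Γ(1−2x)/Γ(1−x)²`. -/
theorem symMT_eq_iteratedDeriv (n : ℕ) (hn : 0 < n) :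
    symMT n (fun _ => 1) =
      iteratedDeriv n (fun x : ℝ => Real.Gamma (1 - 2 * x) / Real.Gamma (1 - x) ^ 2) 0 := by
  exact (symMT_eq_Z n).trans (MT_final n)
end

section
/- For every real number x with |x| < 1/2, the Taylor expansion ln( Γ(1−2x) / Γ(1−x)² ) = Σ_{k=2}^{∞} (2^k − 2) · (ζ(k)/k) · x^k holds, where ζ is the Riemann zeta function; in particular the coefficients of x^0 and x^1 vanish. -/
open Filter Topology in
theorem aux_term (y : ℝ) (hy : |y| < 1 / 2) :
    HasSum (fun k : ℕ => ((2 : ℝ) ^ (k + 2) - 2) / ((k : ℝ) + 2) * y ^ (k + 2))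
      (2 * Real.log (1 - y) - Real.log (1 - 2 * y)) := by
  have h1 := Real.hasSum_pow_div_log_of_abs_lt_one (x := y) (by linarith)
  have h2 := Real.hasSum_pow_div_log_of_abs_lt_one (x := 2 * y)
    (by rw [abs_mul, abs_of_pos (by norm_num : (0 : ℝ) < 2)]; linarith)
  have h3 := h2.sub (h1.mul_left 2)
  rw [← hasSum_nat_add_iff' 1] at h3
  convert h3 using 1
  · rfl
  · funext k
    push_cast
    have : (k : ℝ) + 2 ≠ 0 := by positivity
    have e : (k : ℝ) + 1 + 1 = k + 2 := by ring
    rw [e, mul_pow]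
    field_simp
    try ring
  · simp
    ring

open Filter Topology in
theorem aux_limit (x : ℝ) (hx : |x| < 1 / 2) :
    Tendsto (fun n : ℕ => ∑ m ∈ Finset.range (n + 1),
      (2 * Real.log (1 - x / ((m : ℝ) + 1)) - Real.log (1 - 2 * (x / ((m : ℝ) + 1))))) atTop
      (𝓝 (Real.log (Real.Gamma (1 - 2 * x) / Real.Gamma (1 - x) ^ 2))) := by
  obtain ⟨hl, hr⟩ := abs_lt.mp hx
  have p1 : 0 < 1 - 2 * x := by linarith
  have p2 : 0 < 1 - x := by linarith
  have t1 := Real.BohrMollerup.tendsto_log_gamma p1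
  have t2 := Real.BohrMollerup.tendsto_log_gamma p2
  have t3 := (t1.sub (t2.const_mul 2)).sub Real.tendsto_log_nat_add_one_sub_log
  have e : Real.log (Real.Gamma (1 - 2 * x) / Real.Gamma (1 - x) ^ 2) =
      Real.log (Real.Gamma (1 - 2 * x)) - 2 * Real.log (Real.Gamma (1 - x)) - 0 := by
    rw [Real.log_div (Real.Gamma_pos_of_pos p1).ne' (pow_pos (Real.Gamma_pos_of_pos p2) 2).ne',
      Real.log_pow]
    push_cast
    ring
  rw [e]
  refine t3.congr fun n => ?_
  have hf : ∀ n : ℕ, Real.log (n.factorial : ℝ) + Real.log ((n : ℝ) + 1)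
      = ∑ m ∈ Finset.range (n + 1), Real.log ((m : ℝ) + 1) := by
    intro n
    induction n with
    | zero => simp
    | succ n ih =>
      rw [Finset.sum_range_succ, ← ih, Nat.factorial_succ, Nat.cast_mul, Real.log_mul
        (by positivity) (by positivity)]
      push_cast
      ring
  have hs : ∀ m : ℕ, 2 * Real.log (1 - x / ((m : ℝ) + 1)) - Real.log (1 - 2 * (x / ((m : ℝ) + 1)))
      = 2 * Real.log (1 - x + m) - Real.log (1 - 2 * x + m) - Real.log ((m : ℝ) + 1) := by
    intro m
    have hm : (0 : ℝ) < (m : ℝ) + 1 := by positivity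
    have hm0 : (0 : ℝ) ≤ m := by positivity
    have e1 : 1 - x / ((m : ℝ) + 1) = (1 - x + m) / ((m : ℝ) + 1) := by
      field_simp; ring
    have e2 : 1 - 2 * (x / ((m : ℝ) + 1)) = (1 - 2 * x + m) / ((m : ℝ) + 1) := by
      field_simp; ring
    rw [e1, e2, Real.log_div (by linarith) hm.ne', Real.log_div (by linarith) hm.ne']
    ring
  simp_rw [hs]
  rw [Finset.sum_sub_distrib, Finset.sum_sub_distrib, ← Finset.mul_sum, ← hf n]
  unfold Real.BohrMollerup.logGammaSeq
  ring

theorem aux_real (x : ℝ) (hx : |x| < 1 / 2) :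
    HasSum (fun k : ℕ => ((2 : ℝ) ^ (k + 2) - 2) / ((k : ℝ) + 2) * x ^ (k + 2) *
        ∑' m : ℕ, 1 / ((m : ℝ) + 1) ^ (k + 2))
      (Real.log (Real.Gamma (1 - 2 * x) / Real.Gamma (1 - x) ^ 2)) := by
  set F : ℕ × ℕ → ℝ := fun p => ((2 : ℝ) ^ (p.1 + 2) - 2) / ((p.1 : ℝ) + 2) * x ^ (p.1 + 2) *
        (1 / ((p.2 : ℝ) + 1) ^ (p.1 + 2)) with hF
  have hz : ∀ k : ℕ, Summable fun m : ℕ => 1 / ((m : ℝ) + 1) ^ (k + 2) := by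
    intro k
    have := (summable_nat_add_iff 1).mpr
      (Real.summable_one_div_nat_pow (p := k + 2) |>.mpr (by omega))
    simpa using this
  have hg : Summable fun k : ℕ => |2 * x| ^ (k + 2) := by
    refine (summable_nat_add_iff 2).mpr (summable_geometric_of_lt_one (abs_nonneg _) ?_)
    rw [abs_mul, abs_of_pos (by norm_num : (0 : ℝ) < 2)]; linarith
  have hS : Summable F := by
    refine Summable.of_norm_bounded (hg.mul_of_nonneg (hz 0) (fun k => by positivity)
      (fun m => by positivity)) ?_
    rintro ⟨k, m⟩
    simp only [hF, Real.norm_eq_abs, abs_mul]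
    have h2 : (2 : ℝ) ≤ 2 ^ (k + 2) := by
      have : (1 : ℝ) ≤ 2 ^ k := one_le_pow₀ (by norm_num)
      rw [pow_add]; linarith
    have a1 : |((2 : ℝ) ^ (k + 2) - 2) / ((k : ℝ) + 2)| ≤ 2 ^ (k + 2) := by
      rw [abs_of_nonneg (div_nonneg (by linarith) (by positivity))]
      have hk : (1 : ℝ) ≤ (k : ℝ) + 2 := by have : (0 : ℝ) ≤ k := by positivity
                                            linarith
      exact (div_le_self (by linarith) hk).trans (by linarith)
    have a2 : |1 / ((m : ℝ) + 1) ^ (k + 2)| ≤ 1 / ((m : ℝ) + 1) ^ (0 + 2) := by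
      rw [abs_of_nonneg (by positivity)]
      refine one_div_le_one_div_of_le (by positivity) (pow_le_pow_right₀ ?_ (by omega))
      have : (0 : ℝ) ≤ m := by positivity
      linarith
    have a3 : |(2 : ℝ)| = 2 := abs_of_pos (by norm_num)
    rw [a3, mul_pow, abs_pow]
    gcongr
  obtain ⟨S, hFS⟩ := hS
  have hc := ((Equiv.prodComm ℕ ℕ).hasSum_iff.mpr hFS).prod_fiberwise
    (g := fun m : ℕ => 2 * Real.log (1 - x / ((m : ℝ) + 1))
      - Real.log (1 - 2 * (x / ((m : ℝ) + 1)))) (fun m => by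
      have hb : |x / ((m : ℝ) + 1)| < 1 / 2 := by
        rw [abs_div, abs_of_pos (by positivity : (0 : ℝ) < (m : ℝ) + 1)]
        refine (div_le_self (abs_nonneg _) ?_).trans_lt hx
        have : (0 : ℝ) ≤ m := by positivity
        linarith
      convert aux_term _ hb using 1
      funext k
      simp only [hF, Function.comp, Equiv.prodComm_apply, Prod.swap, div_pow]
      ring)
  have hlim := (Filter.tendsto_add_atTop_iff_nat 1).mpr hc.tendsto_sum_nat
  rw [tendsto_nhds_unique (aux_limit x hx) hlim]
  exact hFS.prod_fiberwise fun k => (hz k).hasSum.mul_left _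

/-- For every real `x` with `|x| < 1/2`,
`ln(Γ(1−2x)/Γ(1−x)²) = Σ_{k=2}^∞ (2^k − 2)·(ζ(k)/k)·x^k` (in particular the
coefficients of `x⁰` and `x¹` vanish, so the sum starts at `k = 2`). -/
theorem hasSum_log_gamma_ratio (x : ℝ) (hx : |x| < 1 / 2) :
    HasSum
      (fun k : ℕ =>
        ((2 : ℂ) ^ (k + 2) - 2) * (riemannZeta ((k : ℂ) + 2) / ((k : ℂ) + 2)) * (x : ℂ) ^ (k + 2))
      ((Real.log (Real.Gamma (1 - 2 * x) / Real.Gamma (1 - x) ^ 2) : ℝ) : ℂ) := by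
  convert Complex.hasSum_ofReal.mpr (aux_real x hx) using 1
  funext k
  have hz : riemannZeta ((k : ℂ) + 2) = ∑' m : ℕ, 1 / ((m : ℂ) + 1) ^ (k + 2) := by
    rw [zeta_eq_tsum_one_div_nat_add_one_cpow (by
      have : (0 : ℝ) ≤ k := by positivity
      simp
      linarith)]
    refine tsum_congr fun m => ?_
    rw [← Complex.cpow_natCast]
    push_cast
    rfl
  rw [hz]
  push_cast
  ring
end

section
/- The sum over all triples (a₁, a₂, a₃) of nonzero integers with a₁ + a₂ + a₃ = 0 of 1/|a₁ a₂ a₃| equals 12ζ(3), where ζ is the Riemann zeta function. -/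
/-- `ζ̄_3`: the sum of `1/|a₁ a₂ a₃|` over all triples of nonzero integers with
`a₁ + a₂ + a₃ = 0`. -/
noncomputable def symMT3 : ℝ :=
  ∑' a : {a : Fin 3 → ℤ // (∀ i, a i ≠ 0) ∧ ∑ i, a i = 0},
    1 / |∏ i, ((a.1 i : ℝ))|

open Finset Filter Topology

noncomputable def mtF (p : ℕ × ℕ) : ℝ :=
  1 / (((p.1 : ℝ) + 1) * ((p.2 : ℝ) + 1) * ((p.1 : ℝ) + p.2 + 2))

noncomputable def mtG (p : ℕ × ℕ) : ℝ :=
  1 / (((p.1 : ℝ) + 1) * ((p.1 : ℝ) + p.2 + 2) ^ 2)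

noncomputable def mtH (n : ℕ) : ℝ := ∑ i ∈ range n, 1 / ((i : ℝ) + 1)

lemma mt_congr {f g : ℕ → ℝ} {a : ℝ} (h : HasSum f a) (e : ∀ n, g n = f n) : HasSum g a := by
  rwa [funext e]

lemma mtF_nonneg (p : ℕ × ℕ) : 0 ≤ mtF p := by unfold mtF; positivity

lemma mtG_nonneg (p : ℕ × ℕ) : 0 ≤ mtG p := by unfold mtG; positivity

lemma mtF_eq (p : ℕ × ℕ) : mtF p = mtG p + mtG p.swap := by
  obtain ⟨m, n⟩ := p
  simp only [mtF, mtG, Prod.swap]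
  have h1 : (m : ℝ) + 1 ≠ 0 := by positivity
  have h2 : (n : ℝ) + 1 ≠ 0 := by positivity
  have h3 : (m : ℝ) + n + 2 ≠ 0 := by positivity
  rw [add_comm (n : ℝ) m]
  field_simp
  ring

lemma summable_mtF : Summable mtF := by
  have h0 : Summable (fun n : ℕ => 1 / ((n : ℝ) + 1) ^ (3 / 2 : ℝ)) := by
    have := (summable_nat_add_iff 1).2
      (Real.summable_one_div_nat_rpow.2 (by norm_num : (1 : ℝ) < 3 / 2))
    simpa using this
  have h1 := h0.mul_of_nonneg h0 (fun n => by positivity) (fun n => by positivity)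
  refine Summable.of_nonneg_of_le mtF_nonneg ?_ h1
  rintro ⟨m, n⟩
  simp only [mtF]
  have ha : (0 : ℝ) < (m : ℝ) + 1 := by positivity
  have hb : (0 : ℝ) < (n : ℝ) + 1 := by positivity
  rw [div_mul_div_comm, one_mul]
  apply one_div_le_one_div_of_le (by positivity)
  rw [← Real.mul_rpow ha.le hb.le]
  set c : ℝ := ((m : ℝ) + 1) * ((n : ℝ) + 1) with hc
  have hc0 : 0 < c := by positivity
  have : c ^ (3 / 2 : ℝ) = c * √c := by
    rw [show (3 / 2 : ℝ) = 1 + 1 / 2 by norm_num, Real.rpow_add hc0, Real.rpow_one,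
      Real.sqrt_eq_rpow]
  rw [this]
  apply mul_le_mul_of_nonneg_left _ hc0.le
  apply Real.sqrt_le_iff.2
  constructor
  · positivity
  · nlinarith [sq_nonneg ((m : ℝ) - n)]

lemma summable_mtG : Summable mtG := by
  refine Summable.of_nonneg_of_le mtG_nonneg (fun p => ?_) summable_mtF
  rw [mtF_eq]
  linarith [mtG_nonneg p.swap]

lemma tsum_mtF_eq_two : ∑' p, mtF p = 2 * ∑' p, mtG p := by
  have hs : Summable (fun p : ℕ × ℕ => mtG p.swap) :=
    (Equiv.prodComm ℕ ℕ).summable_iff.2 summable_mtG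
  have he : ∑' p : ℕ × ℕ, mtG p.swap = ∑' p, mtG p := (Equiv.prodComm ℕ ℕ).tsum_eq mtG
  simp_rw [mtF_eq]
  rw [summable_mtG.tsum_add hs, he]
  ring

lemma hasSum_tele (n : ℕ) :
    HasSum (fun m : ℕ => 1 / ((m : ℝ) + n + 1) - 1 / ((m : ℝ) + n + 2)) (1 / ((n : ℝ) + 1)) := by
  rw [hasSum_iff_tendsto_nat_of_nonneg]
  · have h : ∀ M : ℕ, ∑ m ∈ range M, (1 / ((m : ℝ) + n + 1) - 1 / ((m : ℝ) + n + 2))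
        = 1 / ((n : ℝ) + 1) - 1 / (((M + n : ℕ) : ℝ) + 1) := by
      intro M
      induction M with
      | zero => simp
      | succ k ih =>
        rw [sum_range_succ, ih]
        push_cast
        ring_nf
    simp_rw [h]
    have := (tendsto_one_div_add_atTop_nhds_zero_nat (𝕜 := ℝ)).comp (tendsto_add_atTop_nat n)
    simpa using this.const_sub (1 / ((n : ℝ) + 1))
  · intro m
    rw [sub_nonneg]
    apply one_div_le_one_div_of_le (by positivity)
    linarith

lemma hasSum_harm (n : ℕ) :
    HasSum (fun m : ℕ => 1 / ((m : ℝ) + 1) - 1 / ((m : ℝ) + n + 1)) (mtH n) := by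
  induction n with
  | zero => simp [mtH]
  | succ k ih =>
    have := ih.add (hasSum_tele k)
    have e : mtH (k + 1) = mtH k + 1 / ((k : ℝ) + 1) := sum_range_succ _ _
    rw [e]
    refine mt_congr this fun m => ?_
    push_cast
    ring

lemma tsum_mtF_harm : HasSum (fun n : ℕ => mtH (n + 1) / ((n : ℝ) + 1) ^ 2) (∑' p, mtF p) := by
  have hs : Summable (fun p : ℕ × ℕ => mtF p.swap) :=
    (Equiv.prodComm ℕ ℕ).summable_iff.2 summable_mtF
  have he : ∑' p : ℕ × ℕ, mtF p.swap = ∑' p, mtF p := (Equiv.prodComm ℕ ℕ).tsum_eq mtF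
  rw [← he]
  refine hs.hasSum.prod_fiberwise (fun n => ?_)
  have := (hasSum_harm (n + 1)).div_const (((n : ℝ) + 1) ^ 2)
  refine mt_congr this fun m => ?_
  simp only [mtF, Prod.swap]
  push_cast
  have h1 : (m : ℝ) + 1 ≠ 0 := by positivity
  have h2 : (n : ℝ) + 1 ≠ 0 := by positivity
  have h3 : (m : ℝ) + n + 2 ≠ 0 := by positivity
  have h4 : (m : ℝ) + (n + 1) + 1 = m + n + 2 := by ring
  rw [h4]
  field_simp
  ring

lemma tsum_mtG_harm : HasSum (fun k : ℕ => mtH (k + 1) / ((k : ℝ) + 2) ^ 2) (∑' p, mtG p) := by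
  have h := (Finset.HasAntidiagonal.sigmaAntidiagonalEquivProd (A := ℕ)).hasSum_iff.2 summable_mtG.hasSum
  refine h.sigma (fun k => ?_)
  have h2 : mtH (k + 1) / ((k : ℝ) + 2) ^ 2 = ∑ p ∈ antidiagonal k, mtG p := by
    rw [Finset.Nat.sum_antidiagonal_eq_sum_range_succ_mk, mtH, sum_div]
    refine sum_congr rfl fun i hi => ?_
    have hi' : i ≤ k := by simpa [Nat.lt_succ_iff] using hi
    simp only [mtG]
    push_cast [Nat.cast_sub hi']
    rw [div_div]
    congr 3
    ring
  rw [h2]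
  exact Finset.hasSum (antidiagonal k) mtG

lemma tsum_cube : HasSum (fun k : ℕ => 1 / ((k : ℝ) + 1) ^ 3) (∑' p, mtG p) := by
  have h1 := tsum_mtF_harm
  rw [tsum_mtF_eq_two] at h1
  have h2 : HasSum (fun k : ℕ => mtH k / ((k : ℝ) + 1) ^ 2) (∑' p, mtG p) := by
    rw [← hasSum_nat_add_iff' 1]
    have e : ∑' p, mtG p - ∑ i ∈ range 1, mtH i / ((i : ℝ) + 1) ^ 2 = ∑' p, mtG p := by
      simp [mtH]
    rw [e]
    refine mt_congr tsum_mtG_harm fun k => ?_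
    push_cast
    ring
  have h3 := h1.sub h2
  have e : 2 * ∑' p, mtG p - ∑' p, mtG p = ∑' p, mtG p := by ring
  rw [e] at h3
  refine mt_congr h3 fun k => ?_
  have e : mtH (k + 1) = mtH k + 1 / ((k : ℝ) + 1) := sum_range_succ _ _
  rw [e]
  have : (k : ℝ) + 1 ≠ 0 := by positivity
  field_simp
  ring

lemma zeta_three : riemannZeta 3 = ((∑' p, mtG p : ℝ) : ℂ) := by
  have h := zeta_eq_tsum_one_div_nat_add_one_cpow (s := 3) (by norm_num)
  rw [h, ← tsum_cube.tsum_eq, Complex.ofReal_tsum]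
  refine tsum_congr fun n => ?_
  push_cast
  norm_cast

abbrev MTIdx := {a : Fin 3 → ℤ // (∀ i, a i ≠ 0) ∧ ∑ i, a i = 0}

def mtVec (s : Bool) (i : Fin 3) (m n : ℕ) : Fin 3 → ℤ :=
  match s, i with
  | true, 0 => ![-(m + n + 2 : ℤ), m + 1, n + 1]
  | true, 1 => ![(m + 1 : ℤ), -(m + n + 2 : ℤ), n + 1]
  | true, 2 => ![(m + 1 : ℤ), n + 1, -(m + n + 2 : ℤ)]
  | false, 0 => ![(m + n + 2 : ℤ), -(m + 1 : ℤ), -(n + 1 : ℤ)]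
  | false, 1 => ![-(m + 1 : ℤ), (m + n + 2 : ℤ), -(n + 1 : ℤ)]
  | false, 2 => ![-(m + 1 : ℤ), -(n + 1 : ℤ), (m + n + 2 : ℤ)]

lemma mtVec_mem (s : Bool) (i : Fin 3) (m n : ℕ) :
    (∀ j, mtVec s i m n j ≠ 0) ∧ ∑ j, mtVec s i m n j = 0 := by
  cases s <;> fin_cases i <;> simp [mtVec, Fin.forall_fin_succ, Fin.sum_univ_three] <;> omega

def mtMap (x : (Bool × Fin 3) × (ℕ × ℕ)) : MTIdx :=
  ⟨mtVec x.1.1 x.1.2 x.2.1 x.2.2, mtVec_mem _ _ _ _⟩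

lemma mtMap_inj : Function.Injective mtMap := by
  rintro ⟨⟨s, i⟩, m, n⟩ ⟨⟨t, j⟩, p, q⟩ h
  have h' : mtVec s i m n = mtVec t j p q := congrArg Subtype.val h
  have h0 := congrFun h' 0
  have h1 := congrFun h' 1
  have h2 := congrFun h' 2
  clear h h'
  cases s <;> cases t <;> fin_cases i <;> fin_cases j <;> simp [mtVec] at h0 h1 h2 ⊢ <;> omega

lemma mtMap_surj : Function.Surjective mtMap := by
  rintro ⟨a, ha, hs⟩
  have h0 := ha 0
  have h1 := ha 1
  have h2 := ha 2
  rw [Fin.sum_univ_three] at hs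
  have key : ∀ s i m n, mtVec s i m n 0 = a 0 → mtVec s i m n 1 = a 1 → mtVec s i m n 2 = a 2 →
      ∃ x, mtMap x = ⟨a, ha, by rw [Fin.sum_univ_three]; exact hs⟩ := by
    intro s i m n e0 e1 e2
    refine ⟨((s, i), (m, n)), Subtype.ext ?_⟩
    funext j
    fin_cases j
    · exact e0
    · exact e1
    · exact e2
  rcases lt_or_gt_of_ne h0 with g0 | g0 <;> rcases lt_or_gt_of_ne h1 with g1 | g1 <;>
    rcases lt_or_gt_of_ne h2 with g2 | g2
  · omega
  · apply key false 2 (-a 0 - 1).toNat (-a 1 - 1).toNat <;> simp [mtVec] <;> omega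
  · apply key false 1 (-a 0 - 1).toNat (-a 2 - 1).toNat <;> simp [mtVec] <;> omega
  · apply key true 0 (a 1 - 1).toNat (a 2 - 1).toNat <;> simp [mtVec] <;> omega
  · apply key false 0 (-a 1 - 1).toNat (-a 2 - 1).toNat <;> simp [mtVec] <;> omega
  · apply key true 1 (a 0 - 1).toNat (a 2 - 1).toNat <;> simp [mtVec] <;> omega
  · apply key true 2 (a 0 - 1).toNat (a 1 - 1).toNat <;> simp [mtVec] <;> omega
  · omega

lemma mtMap_val (x : (Bool × Fin 3) × (ℕ × ℕ)) :
    1 / |∏ i, (((mtMap x).1 i : ℝ))| = 1 * mtF x.2 := by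
  obtain ⟨⟨s, i⟩, m, n⟩ := x
  rw [one_mul, mtF]
  congr 1
  have hp : (0 : ℝ) ≤ ((m : ℝ) + 1) * ((n : ℝ) + 1) * ((m : ℝ) + n + 2) := by positivity
  rw [← abs_of_nonneg hp]
  rw [abs_eq_abs]
  cases s
  · left
    fin_cases i <;> simp [mtMap, mtVec, Fin.prod_univ_three, -mul_eq_mul_left_iff,
      -mul_eq_mul_right_iff] <;> ring
  · right
    fin_cases i <;> simp [mtMap, mtVec, Fin.prod_univ_three, -mul_eq_mul_left_iff,
      -mul_eq_mul_right_iff] <;> ring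

lemma symMT3_real : symMT3 = 6 * ∑' p, mtF p := by
  unfold symMT3
  have hb : Function.Bijective mtMap := ⟨mtMap_inj, mtMap_surj⟩
  have h0 := (Equiv.ofBijective mtMap hb).tsum_eq (fun a : MTIdx => 1 / |∏ i, ((a.1 i : ℝ))|)
  simp only [Equiv.ofBijective_apply, mtMap_val] at h0
  rw [← h0]
  have h1 : Summable (fun _ : Bool × Fin 3 => ‖(1 : ℝ)‖) := (hasSum_fintype _).summable
  have := tsum_mul_tsum_of_summable_norm (f := fun _ : Bool × Fin 3 => (1 : ℝ)) (g := mtF)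
    h1 summable_mtF.norm
  rw [← this, tsum_fintype]
  simp

/-- `ζ̄_3 = 12ζ(3)`. -/
theorem symMT3_eq : (symMT3 : ℂ) = 12 * riemannZeta 3 := by
  rw [symMT3_real, tsum_mtF_eq_two, zeta_three]
  push_cast
  ring
end
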